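/- arXiv:2210.11462 — 3 statements merged into one kernel-verified Lean document; each statement's English description precedes it below -/
import Mathlib

section
/- Let f be a function on a convex subset P₀ of P_n taking values in [0,+∞] and satisfying, for all p̄, q̄ ∈ P₀ and λ ∈ [0,1] (with possible value +∞ on both sides), the inequalities f(λp̄+(1−λ)q̄) ≥ λf(p̄)+(1−λ)f(q̄)−a_f(λ) and f(λp̄+(1−λ)q̄) ≤ λf(p̄)+(1−λ)f(q̄)+b_f(λ), where a_f, b_f are continuous functions on [0,1] with a_f(0)=b_f(0)=0, a_f(λ)=a_f(1−λ) and b_f(λ)=b_f(1−λ) for all λ∈[0,1], and a_f, b_f are concave and non-decreasing on [0,1/2]. Let p̄ ∈ P₀ be a distribution such that (a) h(p̄) ∈ cone(P₀) for every function h : ℝ₊ → ℝ₊ with h(x) ≤ x for all x ≥ 0 (where h(p̄) is the entrywise application of h), and (b) the entrywise positive and negative parts [p̄−q̄]₊ and [p̄−q̄]₋ belong to cone(P₀) for every q̄ ∈ P₀ with q̄ ≠ p̄. Assume that either f(p̄) < +∞ or f̃([p̄−ε]₊) < +∞ for all ε ∈ (0,1]. Then for every ε ∈ (0,1] and every q̄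 ∈ P₀ with TV(p̄,q̄) ≤ ε one has f(q̄) ≥ f̃([p̄−ε]₊) − D_f(ε) − ã_f(ε) − a_f(1−r_ε), where r_ε = ‖[p̄−ε]₊‖₁ = ∑ max(p_{i₁...i_n}−ε,0), D_f(ε) = (1+ε)·(a_f+b_f)(ε/(1+ε)) and ã_f(ε) = a_f(ε) for ε ∈ [0,1/2], ã_f(ε) = a_f(1/2) for ε ∈ (1/2,1]. -/
open scoped ENNReal

/-- The set of `n`-variate probability distributions: families of nonnegative reals
indexed by `ℕⁿ` that are summable with total sum `1`. -/
def distrSet (n : ℕ) : Set ((Fin n → ℕ) → ℝ) :=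
  {p | (∀ i, 0 ≤ p i) ∧ Summable p ∧ ∑' i, p i = 1}

/-- Total variation distance. -/
noncomputable def TV {n : ℕ} (p q : (Fin n → ℕ) → ℝ) : ℝ :=
  (1 / 2) * ∑' i, |p i - q i|

/-- The cone generated by a set of distributions. -/
def coneOf {n : ℕ} (P0 : Set ((Fin n → ℕ) → ℝ)) : Set ((Fin n → ℕ) → ℝ) :=
  {a | ∃ c : ℝ, 0 ≤ c ∧ ∃ p ∈ P0, a = c • p}

/-- The homogeneous extension `f̃(ā) = ‖ā‖₁ · f(ā/‖ā‖₁)` (equal to `0` at `ā = 0`). -/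
noncomputable def ftilde {n : ℕ} (f : ((Fin n → ℕ) → ℝ) → ℝ≥0∞)
    (a : (Fin n → ℕ) → ℝ) : ℝ≥0∞ :=
  ENNReal.ofReal (∑' i, a i) * f (fun i => a i / ∑' i, a i)

section ErrorFunction

variable {g : ℝ → ℝ}

theorem errorFun_nonneg (g0 : g 0 = 0) (gsym : ∀ l ∈ Set.Icc (0 : ℝ) 1, g l = g (1 - l))
    (gmono : MonotoneOn g (Set.Icc 0 (1 / 2))) {l : ℝ} (hl : l ∈ Set.Icc (0 : ℝ) 1) :
    0 ≤ g l := by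
  have key : ∀ x ∈ Set.Icc (0 : ℝ) (1 / 2), 0 ≤ g x := fun x hx => by
    rw [← g0]
    exact gmono ⟨le_rfl, by norm_num⟩ hx hx.1
  rcases le_total l (1 / 2) with h | h
  · exact key l ⟨hl.1, h⟩
  · rw [gsym l hl]
    exact key _ ⟨by linarith [hl.2], by linarith⟩

theorem errorFun_le_half (gsym : ∀ l ∈ Set.Icc (0 : ℝ) 1, g l = g (1 - l))
    (gmono : MonotoneOn g (Set.Icc 0 (1 / 2))) {l : ℝ} (hl : l ∈ Set.Icc (0 : ℝ) 1) :
    g l ≤ g (1 / 2) := by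
  have key : ∀ x ∈ Set.Icc (0 : ℝ) (1 / 2), g x ≤ g (1 / 2) := fun x hx =>
    gmono hx ⟨by norm_num, le_rfl⟩ hx.2
  rcases le_total l (1 / 2) with h | h
  · exact key l ⟨hl.1, h⟩
  · rw [gsym l hl]
    exact key _ ⟨by linarith [hl.2], by linarith⟩

theorem smul_le_of_concaveOn_half (g0 : g 0 = 0) (gconc : ConcaveOn ℝ (Set.Icc 0 (1 / 2)) g)
    {c x : ℝ} (hc : c ∈ Set.Icc (0 : ℝ) 1) (hx : x ∈ Set.Icc (0 : ℝ) (1 / 2)) :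
    c * g x ≤ g (c * x) := by
  have := gconc.2 hx (⟨le_rfl, by norm_num⟩ : (0 : ℝ) ∈ Set.Icc (0 : ℝ) (1 / 2)) hc.1
    (sub_nonneg.2 hc.2) (by ring)
  simpa [g0] using this

/-- The perspective `N ↦ N * g (d / N)` is nondecreasing, in the range needed here. -/
theorem errorFun_perspective_mono (g0 : g 0 = 0)
    (gsym : ∀ l ∈ Set.Icc (0 : ℝ) 1, g l = g (1 - l))
    (gconc : ConcaveOn ℝ (Set.Icc 0 (1 / 2)) g)
    (gmono : MonotoneOn g (Set.Icc 0 (1 / 2))) {d M N : ℝ} (hd : 0 ≤ d) (hdM : d ≤ M)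
    (hMN : M ≤ N) (hN : 0 < N) (hdN : d ≤ N / 2) :
    M * g (d / M) ≤ N * g (d / N) := by
  have hM0 : 0 ≤ M := hd.trans hdM
  rcases hM0.eq_or_lt with rfl | hM
  · have : d = 0 := le_antisymm hdM hd
    simp [this, g0]
  have hc : M / N ∈ Set.Icc (0 : ℝ) 1 := ⟨by positivity, (div_le_one hN).2 hMN⟩
  rcases le_total d (M / 2) with h | h
  · have hx : d / M ∈ Set.Icc (0 : ℝ) (1 / 2) :=
      ⟨by positivity, by rw [div_le_iff₀ hM]; linarith⟩
    have := smul_le_of_concaveOn_half g0 gconc hc hx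
    have e : M / N * (d / M) = d / N := by field_simp
    rw [e, div_mul_eq_mul_div, div_le_iff₀ hN] at this
    linarith
  · have h1 : g (d / M) ≤ g (1 / 2) :=
      errorFun_le_half gsym gmono ⟨by positivity, (div_le_one hM).2 hdM⟩
    have h2 := smul_le_of_concaveOn_half g0 gconc hc
      (⟨by norm_num, le_rfl⟩ : (1 / 2 : ℝ) ∈ Set.Icc (0 : ℝ) (1 / 2))
    have h3 : g (M / N * (1 / 2)) ≤ g (d / N) := by
      refine gmono ⟨by positivity, ?_⟩ ⟨by positivity, ?_⟩ ?_
      · linarith [hc.2]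
      · rw [div_le_iff₀ hN]; linarith
      · rw [div_mul_eq_mul_div]
        gcongr
        linarith
    have h4 : M / N * g (1 / 2) ≤ g (d / N) := h2.trans h3
    rw [div_mul_eq_mul_div, div_le_iff₀ hN] at h4
    calc M * g (d / M) ≤ M * g (1 / 2) := by gcongr
      _ ≤ N * g (d / N) := by linarith

theorem mul_errorFun_div_le (g0 : g 0 = 0)
    (gsym : ∀ l ∈ Set.Icc (0 : ℝ) 1, g l = g (1 - l))
    (gconc : ConcaveOn ℝ (Set.Icc 0 (1 / 2)) g)
    (gmono : MonotoneOn g (Set.Icc 0 (1 / 2))) {d e M : ℝ} (hd : 0 ≤ d) (hdM : d ≤ M)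
    (hM : M ≤ 1) (hde : d ≤ e) :
    M * g (d / M) ≤ g (min e (1 / 2)) := by
  have hM0 : 0 ≤ M := hd.trans hdM
  have hmin : g (min d (1 / 2)) ≤ g (min e (1 / 2)) :=
    gmono ⟨le_min hd (by norm_num), min_le_right _ _⟩
      ⟨le_min (hd.trans hde) (by norm_num), min_le_right _ _⟩ (min_le_min_right _ hde)
  refine le_trans ?_ hmin
  rcases le_total d (1 / 2) with h | h
  · rw [min_eq_left h]
    simpa using errorFun_perspective_mono g0 gsym gconc gmono hd hdM hM one_pos (by linarith)
  · rw [min_eq_right h]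
    have h0 : 0 ≤ g (1 / 2) := errorFun_nonneg g0 gsym gmono ⟨by norm_num, by norm_num⟩
    have h1 : g (d / M) ≤ g (1 / 2) :=
      errorFun_le_half gsym gmono ⟨by positivity, div_le_one_of_le₀ hdM hM0⟩
    nlinarith

end ErrorFunction

section Cone

variable {n : ℕ} {P0 : Set ((Fin n → ℕ) → ℝ)} {x y : (Fin n → ℕ) → ℝ}

theorem coneOf_nonneg (hP0 : P0 ⊆ distrSet n) (hx : x ∈ coneOf P0) (i : Fin n → ℕ) :
    0 ≤ x i := by
  obtain ⟨c, hc, p, hp, rfl⟩ := hx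
  exact mul_nonneg hc ((hP0 hp).1 i)

theorem coneOf_summable (hP0 : P0 ⊆ distrSet n) (hx : x ∈ coneOf P0) : Summable x := by
  obtain ⟨c, hc, p, hp, rfl⟩ := hx
  exact (hP0 hp).2.1.mul_left c

theorem coneOf_exists_tsum_smul (hP0 : P0 ⊆ distrSet n) (hx : x ∈ coneOf P0) :
    ∃ p ∈ P0, x = (∑' i, x i) • p := by
  obtain ⟨c, hc, p, hp, rfl⟩ := hx
  refine ⟨p, hp, ?_⟩
  have : ∑' i, (c • p) i = c := by
    simp [tsum_mul_left, (hP0 hp).2.2]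
  rw [this]

theorem mem_of_mem_coneOf (hP0 : P0 ⊆ distrSet n) (hx : x ∈ coneOf P0) (h1 : ∑' i, x i = 1) :
    x ∈ P0 := by
  obtain ⟨p, hp, e⟩ := coneOf_exists_tsum_smul hP0 hx
  rw [e, h1, one_smul]
  exact hp

theorem coneOf_smul {c : ℝ} (hc : 0 ≤ c) (hx : x ∈ coneOf P0) : c • x ∈ coneOf P0 := by
  obtain ⟨d, hd, p, hp, rfl⟩ := hx
  exact ⟨c * d, mul_nonneg hc hd, p, hp, by rw [mul_smul]⟩

theorem subset_coneOf (hx : x ∈ P0) : x ∈ coneOf P0 := ⟨1, zero_le_one, x, hx, by simp⟩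

theorem coneOf_add (hconv : Convex ℝ P0) (hx : x ∈ coneOf P0) (hy : y ∈ coneOf P0) :
    x + y ∈ coneOf P0 := by
  obtain ⟨c, hc, p, hp, rfl⟩ := hx
  obtain ⟨d, hd, q, hq, rfl⟩ := hy
  rcases hc.eq_or_lt with rfl | hc'
  · exact ⟨d, hd, q, hq, by simp⟩
  have hcd : 0 < c + d := by linarith
  refine ⟨c + d, hcd.le, (c / (c + d)) • p + (d / (c + d)) • q,
    hconv hp hq (by positivity) (by positivity) (by field_simp), ?_⟩
  rw [smul_add, smul_smul, smul_smul]
  congr 2 <;> field_simp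

theorem eq_zero_of_tsum_eq_zero (hP0 : P0 ⊆ distrSet n) (hx : x ∈ coneOf P0)
    (h : ∑' i, x i = 0) : x = 0 := by
  obtain ⟨p, -, e⟩ := coneOf_exists_tsum_smul hP0 hx
  rw [e, h, zero_smul]

theorem ftilde_zero (f : ((Fin n → ℕ) → ℝ) → ℝ≥0∞) : ftilde f 0 = 0 := by
  simp [ftilde]

theorem ftilde_smul (f : ((Fin n → ℕ) → ℝ) → ℝ≥0∞) {c : ℝ} (hc : 0 ≤ c)
    (x : (Fin n → ℕ) → ℝ) : ftilde f (c • x) = ENNReal.ofReal c * ftilde f x := by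
  rcases hc.eq_or_lt with rfl | hc'
  · simp [ftilde]
  have h : (fun i => c * x i / (c * ∑' j, x j)) = fun i => x i / ∑' j, x j := by
    funext i
    exact mul_div_mul_left _ _ hc'.ne'
  simp only [ftilde, Pi.smul_apply, smul_eq_mul, tsum_mul_left, h]
  rw [ENNReal.ofReal_mul hc, mul_assoc]

theorem ftilde_of_mem (hP0 : P0 ⊆ distrSet n) (f : ((Fin n → ℕ) → ℝ) → ℝ≥0∞) (hx : x ∈ P0) :
    ftilde f x = f x := by
  simp [ftilde, (hP0 hx).2.2]

/-- Normalized form of the sum of two nonzero elements of the cone. -/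
theorem coneOf_add_normal_form (hP0 : P0 ⊆ distrSet n) (hx : x ∈ coneOf P0)
    (hy : y ∈ coneOf P0) (hX : 0 < ∑' i, x i) (f : ((Fin n → ℕ) → ℝ) → ℝ≥0∞)
    (hconv : Convex ℝ P0) :
    ∃ l ∈ Set.Icc (0 : ℝ) 1, l = (∑' i, x i) / ∑' i, (x i + y i) ∧ ∃ p ∈ P0, ∃ q ∈ P0,
      0 < ∑' i, (x i + y i) ∧
      ftilde f x = ENNReal.ofReal (∑' i, (x i + y i)) * (ENNReal.ofReal l * f p) ∧
      ftilde f y = ENNReal.ofReal (∑' i, (x i + y i)) * (ENNReal.ofReal (1 - l) * f q) ∧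
      ftilde f (x + y) =
        ENNReal.ofReal (∑' i, (x i + y i)) * f (l • p + (1 - l) • q) := by
  have hsum : ∑' i, (x i + y i) = ∑' i, x i + ∑' i, y i :=
    (coneOf_summable hP0 hx).tsum_add (coneOf_summable hP0 hy)
  have hY : 0 ≤ ∑' i, y i := tsum_nonneg (coneOf_nonneg hP0 hy)
  obtain ⟨p, hp, ex⟩ := coneOf_exists_tsum_smul hP0 hx
  obtain ⟨q, hq, ey⟩ := coneOf_exists_tsum_smul hP0 hy
  rw [hsum]
  generalize ∑' i, x i = X at *
  generalize ∑' i, y i = Y at *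
  have hZ : 0 < X + Y := by linarith
  have hl : X / (X + Y) ∈ Set.Icc (0 : ℝ) 1 :=
    ⟨by positivity, (div_le_one hZ).2 (by linarith)⟩
  have e1 : (X + Y) * (X / (X + Y)) = X := by field_simp
  have e2 : (X + Y) * (1 - X / (X + Y)) = Y := by field_simp; ring
  refine ⟨_, hl, rfl, p, hp, q, hq, hZ, ?_, ?_, ?_⟩
  · rw [← mul_assoc, ← ENNReal.ofReal_mul hZ.le, e1, ex, ftilde_smul f hX.le,
      ftilde_of_mem hP0 f hp]
  · rw [← mul_assoc, ← ENNReal.ofReal_mul hZ.le, e2, ey, ftilde_smul f hY,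
      ftilde_of_mem hP0 f hq]
  · have hmem : (X / (X + Y)) • p + (1 - X / (X + Y)) • q ∈ P0 :=
      hconv hp hq hl.1 (sub_nonneg.2 hl.2) (by ring)
    rw [← ftilde_of_mem hP0 f hmem, ← ftilde_smul f hZ.le, smul_add, smul_smul, smul_smul,
      e1, e2, ← ex, ← ey]

theorem ftilde_add_lower (hP0 : P0 ⊆ distrSet n) (hconv : Convex ℝ P0)
    {f : ((Fin n → ℕ) → ℝ) → ℝ≥0∞} {af : ℝ → ℝ}
    (hlow : ∀ p ∈ P0, ∀ q ∈ P0, ∀ l ∈ Set.Icc (0 : ℝ) 1,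
      ENNReal.ofReal l * f p + ENNReal.ofReal (1 - l) * f q
        ≤ f (l • p + (1 - l) • q) + ENNReal.ofReal (af l))
    (hx : x ∈ coneOf P0) (hy : y ∈ coneOf P0) :
    ftilde f x + ftilde f y ≤ ftilde f (x + y) +
      ENNReal.ofReal ((∑' i, (x i + y i)) * af ((∑' i, x i) / ∑' i, (x i + y i))) := by
  rcases (tsum_nonneg (coneOf_nonneg hP0 hx)).eq_or_lt with h | hX
  · rw [eq_zero_of_tsum_eq_zero hP0 hx h.symm, ftilde_zero, zero_add, zero_add]
    exact le_self_add
  obtain ⟨l, hl, el, p, hp, q, hq, hZ, h1, h2, h3⟩ :=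
    coneOf_add_normal_form hP0 hx hy hX f hconv
  rw [h1, h2, h3, ← el, ENNReal.ofReal_mul hZ.le, ← mul_add,
    ← mul_add]
  exact mul_le_mul_right (hlow p hp q hq l hl) _

theorem ftilde_add_upper (hP0 : P0 ⊆ distrSet n) (hconv : Convex ℝ P0)
    {f : ((Fin n → ℕ) → ℝ) → ℝ≥0∞} {bf : ℝ → ℝ}
    (hup : ∀ p ∈ P0, ∀ q ∈ P0, ∀ l ∈ Set.Icc (0 : ℝ) 1,
      f (l • p + (1 - l) • q)
        ≤ ENNReal.ofReal l * f p + ENNReal.ofReal (1 - l) * f q + ENNReal.ofReal (bf l))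
    (hx : x ∈ coneOf P0) (hy : y ∈ coneOf P0) :
    ftilde f (x + y) ≤ ftilde f x + ftilde f y +
      ENNReal.ofReal ((∑' i, (x i + y i)) * bf ((∑' i, x i) / ∑' i, (x i + y i))) := by
  rcases (tsum_nonneg (coneOf_nonneg hP0 hx)).eq_or_lt with h | hX
  · rw [eq_zero_of_tsum_eq_zero hP0 hx h.symm, ftilde_zero, zero_add, zero_add]
    exact le_self_add
  obtain ⟨l, hl, el, p, hp, q, hq, hZ, h1, h2, h3⟩ :=
    coneOf_add_normal_form hP0 hx hy hX f hconv
  rw [h1, h2, h3, ← el, ENNReal.ofReal_mul hZ.le, ← mul_add, ← mul_add]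
  gcongr
  exact hup p hp q hq l hl

/-- If differences with `p` have positive and negative parts in the cone, then so does the
complement `p - x` of every `x ≤ p` in the cone with finitely many values of `x / p`. -/
theorem sub_mem_coneOf_of_finite_ratio (hP0 : P0 ⊆ distrSet n) (hconv : Convex ℝ P0)
    {p : (Fin n → ℕ) → ℝ} (hp : p ∈ P0)
    (hparts : ∀ q ∈ P0, (fun i => max (p i - q i) 0) ∈ coneOf P0 ∧
      (fun i => max (q i - p i) 0) ∈ coneOf P0)
    (hx : x ∈ coneOf P0) (hxp : ∀ i, x i ≤ p i)
    (hfin : (Set.range fun i => x i / p i).Finite) :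
    (fun i => p i - x i) ∈ coneOf P0 := by
  classical
  have hp0 := (hP0 hp).1
  have hps := (hP0 hp).2.1
  have hp1 := (hP0 hp).2.2
  have hpC : p ∈ coneOf P0 := subset_coneOf hp
  have hzero : (fun _ => 0 : (Fin n → ℕ) → ℝ) ∈ coneOf P0 := ⟨0, le_rfl, p, hp, by ext; simp⟩
  have hx0 := coneOf_nonneg hP0 hx
  have hxdiv : ∀ i, x i = x i / p i * p i := fun i => by
    rcases (hp0 i).eq_or_lt with h | h
    · have := hxp i
      rw [← h, mul_zero]
      exact le_antisymm (h ▸ this) (hx0 i)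
    · field_simp
  -- the positive and negative parts of `y - m p`, with `m` the mass of `y`
  have hscaled : ∀ y ∈ coneOf P0, (fun i => max (y i - (∑' j, y j) * p i) 0) ∈ coneOf P0 ∧
      (fun i => max ((∑' j, y j) * p i - y i) 0) ∈ coneOf P0 := by
    intro y hy
    obtain ⟨q, hq, e⟩ := coneOf_exists_tsum_smul hP0 hy
    have hm : 0 ≤ ∑' j, y j := tsum_nonneg (coneOf_nonneg hP0 hy)
    have e' : ∀ i, y i = (∑' j, y j) * q i := fun i => congrFun e i
    constructor
    · convert coneOf_smul hm (hparts q hq).2 using 1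
      ext i
      rw [Pi.smul_apply, smul_eq_mul, mul_max_of_nonneg _ _ hm, mul_zero, mul_sub, ← e' i]
    · convert coneOf_smul hm (hparts q hq).1 using 1
      ext i
      rw [Pi.smul_apply, smul_eq_mul, mul_max_of_nonneg _ _ hm, mul_zero, mul_sub, ← e' i]
  obtain ⟨_, ⟨i₀, rfl⟩, hmax⟩ := Set.exists_max_image _ id hfin (Set.range_nonempty _)
  set M := x i₀ / p i₀ with hM
  have hmax' : ∀ i, x i / p i ≤ M := fun i => hmax _ ⟨i, rfl⟩
  have hM0 : 0 ≤ M := div_nonneg (hx0 _) (hp0 _)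
  have hM1 : M ≤ 1 := div_le_one_of_le₀ (hxp _) (hp0 _)
  have hxM : ∀ i, x i ≤ M * p i := fun i => by
    rw [hxdiv i]
    exact mul_le_mul_of_nonneg_right (hmax' i) (hp0 i)
  rcases hM0.eq_or_lt with h0 | hMpos
  · convert hpC using 2 with i
    have := hxM i
    rw [← h0, zero_mul] at this
    rw [le_antisymm this (hx0 i), sub_zero]
  have hpi₀ : 0 < p i₀ := (hp0 i₀).lt_of_ne fun h => by
    rw [hM, ← h, div_zero] at hMpos
    exact hMpos.false
  have hxi₀ : x i₀ = M * p i₀ := hxdiv i₀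
  obtain ⟨M', hM'mem, hM'max⟩ := Set.exists_max_image
    (insert 0 ((Set.range fun i => x i / p i) \ {M})) id ((hfin.sdiff).insert 0)
    (Set.insert_nonempty _ _)
  have hM'0 : 0 ≤ M' := hM'max 0 (Set.mem_insert _ _)
  have hM'M : M' < M := by
    rcases hM'mem with rfl | ⟨⟨i, rfl⟩, h2⟩
    · exact hMpos
    · exact lt_of_le_of_ne (hmax' i) h2
  have hgap : ∀ i, x i / p i ≠ M → x i ≤ M' * p i := fun i hi => by
    rw [hxdiv i]
    exact mul_le_mul_of_nonneg_right
      (hM'max _ (Set.mem_insert_of_mem _ ⟨⟨i, rfl⟩, hi⟩)) (hp0 i)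
  -- raise the truncation level step by step until it passes the second largest ratio
  have hstep : ∀ s, 0 ≤ s → s ≤ M → (fun i => max (x i - s * p i) 0) ∈ coneOf P0 →
      (fun i => max (s * p i - x i) 0) ∈ coneOf P0 →
      ∃ m, (M - s) * p i₀ ≤ m ∧ s + m ≤ M ∧
      (fun i => max (x i - (s + m) * p i) 0) ∈ coneOf P0 ∧
      (fun i => max ((s + m) * p i - x i) 0) ∈ coneOf P0 := by
    intro s hs0 hsM h1 h2
    set m := ∑' i, max (x i - s * p i) 0 with hm
    have hm0 : 0 ≤ m := tsum_nonneg fun i => le_max_right _ _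
    have hsumm := coneOf_summable hP0 h1
    refine ⟨m, ?_, ?_, ?_, ?_⟩
    · calc (M - s) * p i₀ = x i₀ - s * p i₀ := by rw [hxi₀]; ring
        _ ≤ max (x i₀ - s * p i₀) 0 := le_max_left _ _
        _ ≤ m := hsumm.le_tsum i₀ fun i _ => le_max_right _ _
    · have : m ≤ ∑' i, (M - s) * p i := hsumm.tsum_le_tsum (fun i => by
        refine max_le ?_ (mul_nonneg (sub_nonneg.2 hsM) (hp0 i))
        have := hxM i
        linarith) (hps.mul_left _)
      rw [tsum_mul_left, hp1] at this
      linarith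
    · convert (hscaled _ h1).1 using 2 with i
      rw [← hm]
      have := mul_nonneg hm0 (hp0 i)
      rcases le_total (x i - s * p i) 0 with h | h
      · rw [max_eq_right h, max_eq_right, max_eq_right] <;> nlinarith
      · rw [max_eq_left h]
        congr 1
        ring
    · convert coneOf_add hconv h2 (hscaled _ h1).2 using 1
      ext i
      rw [Pi.add_apply, ← hm]
      have := mul_nonneg hm0 (hp0 i)
      rcases le_total (x i - s * p i) 0 with h | h
      · rw [max_eq_right h, max_eq_left, max_eq_left, max_eq_left] <;> nlinarith
      · rw [max_eq_left h, max_eq_right (by linarith : s * p i - x i ≤ 0), zero_add]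
        congr 1
        ring
  obtain ⟨s, hs0, hsM, hsM', hs1, hs2⟩ : ∃ s, 0 ≤ s ∧ s ≤ M ∧ M' ≤ s ∧
      (fun i => max (x i - s * p i) 0) ∈ coneOf P0 ∧
      (fun i => max (s * p i - x i) 0) ∈ coneOf P0 := by
    set m₀ := (M - M') * p i₀ with hm₀
    have hm₀pos : 0 < m₀ := mul_pos (sub_pos.2 hM'M) hpi₀
    have hiter : ∀ k : ℕ, ∃ s, 0 ≤ s ∧ s ≤ M ∧ (M' ≤ s ∨ k * m₀ ≤ s) ∧
        (fun i => max (x i - s * p i) 0) ∈ coneOf P0 ∧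
        (fun i => max (s * p i - x i) 0) ∈ coneOf P0 := by
      intro k
      induction k with
      | zero =>
        refine ⟨0, le_rfl, hM0, Or.inr (by simp), ?_, ?_⟩
        · convert hx using 2 with i
          simpa using hx0 i
        · convert hzero using 2 with i
          simpa using hx0 i
      | succ k ih =>
        obtain ⟨s, h0, h1, h2, h3, h4⟩ := ih
        by_cases hs : M' ≤ s
        · exact ⟨s, h0, h1, Or.inl hs, h3, h4⟩
        obtain ⟨m, hm1, hm2, hm3, hm4⟩ := hstep s h0 h1 h3 h4
        have hm₀m : m₀ ≤ m := by
          refine le_trans ?_ hm1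
          exact mul_le_mul_of_nonneg_right (by linarith) (hp0 _)
        refine ⟨s + m, by linarith, hm2, Or.inr ?_, hm3, hm4⟩
        have := h2.resolve_left hs
        push_cast
        linarith
    obtain ⟨k, hk⟩ := exists_nat_ge (M' / m₀)
    obtain ⟨s, h0, h1, h2, h3, h4⟩ := hiter k
    refine ⟨s, h0, h1, ?_, h3, h4⟩
    rcases h2 with h | h
    · exact h
    · rw [div_le_iff₀ hm₀pos] at hk
      linarith
  rcases hsM.eq_or_lt with rfl | hsM
  · convert coneOf_add hconv hs2 (coneOf_smul (sub_nonneg.2 hM1) hpC) using 1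
    ext i
    rw [Pi.add_apply, Pi.smul_apply, smul_eq_mul, max_eq_left (sub_nonneg.2 (hxM i))]
    ring
  -- the restrictions of `p` to the set of maximal ratio and to its complement
  set T : (Fin n → ℕ) → ℝ := fun i => if x i / p i = M then p i else 0 with hT
  have hTC : T ∈ coneOf P0 := by
    convert coneOf_smul (inv_nonneg.2 (sub_nonneg.2 hsM.le)) hs1 using 1
    ext i
    have hne : M - s ≠ 0 := (sub_pos.2 hsM).ne'
    rw [Pi.smul_apply, smul_eq_mul]
    by_cases h : x i / p i = M
    · rw [hT, hxdiv i]
      simp only [if_pos h]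
      rw [h, ← sub_mul, max_eq_left (mul_nonneg (sub_pos.2 hsM).le (hp0 i))]
      field_simp
    · have := hgap i h
      have h2 : M' * p i ≤ s * p i := mul_le_mul_of_nonneg_right hsM' (hp0 i)
      rw [hT, max_eq_right (by linarith)]
      simp [h]
  have hTsum : 0 < ∑' j, T j :=
    (coneOf_summable hP0 hTC).tsum_pos (coneOf_nonneg hP0 hTC) i₀ (by simpa [hT, ← hM] using hpi₀)
  have hTle : ∑' j, T j ≤ 1 := by
    rw [← hp1]
    refine (coneOf_summable hP0 hTC).tsum_le_tsum (fun i => ?_) hps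
    simp only [hT]
    split_ifs
    · exact le_rfl
    · exact hp0 i
  have hTc : (fun i => p i - T i) ∈ coneOf P0 := by
    convert coneOf_smul (inv_nonneg.2 hTsum.le) (hscaled T hTC).2 using 1
    ext i
    rw [Pi.smul_apply, smul_eq_mul]
    have := hp0 i
    by_cases h : x i / p i = M
    · have e : T i = p i := by simp [hT, h]
      rw [e, max_eq_right (by nlinarith)]
      simp
    · have e : T i = 0 := by simp [hT, h]
      rw [e, sub_zero, sub_zero, max_eq_left (by positivity)]
      field_simp
  convert coneOf_add hconv (coneOf_add hconv hs2 (coneOf_smul (sub_nonneg.2 hM1) hpC))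
    (coneOf_smul (sub_nonneg.2 hsM.le) hTc) using 1
  ext i
  simp only [Pi.add_apply, Pi.smul_apply, smul_eq_mul]
  by_cases h : x i / p i = M
  · have e : T i = p i := by simp [hT, h]
    have e2 := hxdiv i
    rw [h] at e2
    have := mul_le_mul_of_nonneg_right hsM.le (hp0 i)
    rw [e, max_eq_right (by linarith), e2]
    ring
  · have e : T i = 0 := by simp [hT, h]
    have := hgap i h
    have h2 : M' * p i ≤ s * p i := mul_le_mul_of_nonneg_right hsM' (hp0 i)
    rw [e, max_eq_left (by linarith)]
    ring

theorem ftilde_le_ftilde_add (hP0 : P0 ⊆ distrSet n) (hconv : Convex ℝ P0)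
    {f : ((Fin n → ℕ) → ℝ) → ℝ≥0∞} {af : ℝ → ℝ}
    (haf_sym : ∀ l ∈ Set.Icc (0 : ℝ) 1, af l = af (1 - l))
    (haf_mono : MonotoneOn af (Set.Icc 0 (1 / 2)))
    (hlow : ∀ p ∈ P0, ∀ q ∈ P0, ∀ l ∈ Set.Icc (0 : ℝ) 1,
      ENNReal.ofReal l * f p + ENNReal.ofReal (1 - l) * f q
        ≤ f (l • p + (1 - l) • q) + ENNReal.ofReal (af l))
    (hx : x ∈ coneOf P0) (hy : y ∈ coneOf P0) :
    ftilde f x ≤ ftilde f (x + y) + ENNReal.ofReal ((∑' i, (x i + y i)) * af (1 / 2)) := by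
  refine (le_self_add.trans (ftilde_add_lower hP0 hconv hlow hx hy)).trans ?_
  have hx0 := coneOf_nonneg hP0 hx
  have hy0 := coneOf_nonneg hP0 hy
  have hX : 0 ≤ ∑' i, x i := tsum_nonneg hx0
  have hZ : 0 ≤ ∑' i, (x i + y i) := tsum_nonneg fun i => add_nonneg (hx0 i) (hy0 i)
  have hXZ : ∑' i, x i ≤ ∑' i, (x i + y i) :=
    (coneOf_summable hP0 hx).tsum_le_tsum (fun i => by linarith [hy0 i])
      ((coneOf_summable hP0 hx).add (coneOf_summable hP0 hy))
  gcongr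
  exact errorFun_le_half haf_sym haf_mono ⟨by positivity, div_le_one_of_le₀ hXZ hZ⟩

end Cone

section Truncation

variable {n : ℕ} {P0 : Set ((Fin n → ℕ) → ℝ)} {f : ((Fin n → ℕ) → ℝ) → ℝ≥0∞}
  {af bf : ℝ → ℝ} {p q : (Fin n → ℕ) → ℝ} {ε η : ℝ}

theorem tsum_max_sub_zero_eq_TV (hp : p ∈ distrSet n) (hq : q ∈ distrSet n) :
    ∑' i, max (p i - q i) 0 = TV p q := by
  have h1 : Summable fun i => p i - q i := hp.2.1.sub hq.2.1
  have h2 : Summable fun i => |p i - q i| := h1.abs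
  have e : ∀ i, max (p i - q i) 0 = (1 / 2) * (|p i - q i| + (p i - q i)) := fun i => by
    rcases le_total (p i - q i) 0 with h | h
    · rw [max_eq_right h, abs_of_nonpos h]; ring
    · rw [max_eq_left h, abs_of_nonneg h]; ring
  have h3 : ∑' i, (p i - q i) = 0 := by
    rw [hp.2.1.tsum_sub hq.2.1, hp.2.2, hq.2.2, sub_self]
  rw [tsum_congr e, tsum_mul_left, h2.tsum_add h1, h3, add_zero, TV]

theorem finite_setOf_lt_of_summable {ι : Type*} {x : ι → ℝ} (hx : Summable x) (hη : 0 < η) :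
    {i | η < x i}.Finite := by
  have := hx.tendsto_cofinite_zero.eventually (gt_mem_nhds hη)
  rw [Filter.eventually_cofinite] at this
  exact this.subset fun i (hi : η < x i) => not_lt.2 hi.le

theorem ftilde_truncation_le (hP0 : P0 ⊆ distrSet n) (hconv : Convex ℝ P0)
    (haf_sym : ∀ l ∈ Set.Icc (0 : ℝ) 1, af l = af (1 - l))
    (haf_mono : MonotoneOn af (Set.Icc 0 (1 / 2)))
    (hlow : ∀ p ∈ P0, ∀ q ∈ P0, ∀ l ∈ Set.Icc (0 : ℝ) 1,
      ENNReal.ofReal l * f p + ENNReal.ofReal (1 - l) * f q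
        ≤ f (l • p + (1 - l) • q) + ENNReal.ofReal (af l))
    (hconea : ∀ h : ℝ → ℝ, (∀ x : ℝ, 0 ≤ x → 0 ≤ h x ∧ h x ≤ x) →
      (fun i => h (p i)) ∈ coneOf P0) {h k : ℝ → ℝ}
    (hh : ∀ x : ℝ, 0 ≤ x → 0 ≤ h x) (hhk : ∀ x : ℝ, 0 ≤ x → h x ≤ k x)
    (hk : ∀ x : ℝ, 0 ≤ x → k x ≤ x) :
    ftilde f (fun i => h (p i)) ≤ ftilde f (fun i => k (p i)) +
      ENNReal.ofReal ((∑' i, k (p i)) * af (1 / 2)) := by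
  have h1 := hconea h fun x hx => ⟨hh x hx, (hhk x hx).trans (hk x hx)⟩
  have h2 := hconea (fun x => k x - h x) fun x hx =>
    ⟨sub_nonneg.2 (hhk x hx), by linarith [hh x hx, hk x hx]⟩
  have := ftilde_le_ftilde_add hP0 hconv haf_sym haf_mono hlow h1 h2
  simpa [funext_iff, show ((fun i => h (p i)) + fun i => k (p i) - h (p i)) =
    fun i => k (p i) from funext fun i => add_sub_cancel _ _] using this

/-- The lower bound obtained after removing the part of `p` where it is at most `η`. -/
theorem ftilde_excess_le_of_truncation (hP0 : P0 ⊆ distrSet n) (hconv : Convex ℝ P0)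
    (haf0 : af 0 = 0) (hbf0 : bf 0 = 0)
    (haf_sym : ∀ l ∈ Set.Icc (0 : ℝ) 1, af l = af (1 - l))
    (hbf_sym : ∀ l ∈ Set.Icc (0 : ℝ) 1, bf l = bf (1 - l))
    (haf_conc : ConcaveOn ℝ (Set.Icc 0 (1 / 2)) af)
    (hbf_conc : ConcaveOn ℝ (Set.Icc 0 (1 / 2)) bf)
    (haf_mono : MonotoneOn af (Set.Icc 0 (1 / 2)))
    (hbf_mono : MonotoneOn bf (Set.Icc 0 (1 / 2)))
    (hlow : ∀ p ∈ P0, ∀ q ∈ P0, ∀ l ∈ Set.Icc (0 : ℝ) 1,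
      ENNReal.ofReal l * f p + ENNReal.ofReal (1 - l) * f q
        ≤ f (l • p + (1 - l) • q) + ENNReal.ofReal (af l))
    (hup : ∀ p ∈ P0, ∀ q ∈ P0, ∀ l ∈ Set.Icc (0 : ℝ) 1,
      f (l • p + (1 - l) • q)
        ≤ ENNReal.ofReal l * f p + ENNReal.ofReal (1 - l) * f q + ENNReal.ofReal (bf l))
    (hp : p ∈ P0)
    (hconea : ∀ h : ℝ → ℝ, (∀ x : ℝ, 0 ≤ x → 0 ≤ h x ∧ h x ≤ x) →
      (fun i => h (p i)) ∈ coneOf P0)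
    (hparts : ∀ q ∈ P0, (fun i => max (p i - q i) 0) ∈ coneOf P0 ∧
      (fun i => max (q i - p i) 0) ∈ coneOf P0)
    (hε : 0 < ε) (hη : 0 < η) (hηε : η ≤ ε) (hq : q ∈ P0) (hTV : TV p q ≤ ε)
    (hPfin : ftilde f (fun i => if η < p i then p i else 0) ≠ ∞)
    {κ ε' : ℝ} (hκ : κ = ∑' i, if η < p i then 0 else p i) (hε' : ε' = ε + κ) (hε'1 : ε' ≤ 1) :
    ftilde f (fun i => max (p i - ε') 0) ≤
      f q + ENNReal.ofReal ((1 + ε') * (af (ε' / (1 + ε')) + bf (ε' / (1 + ε'))))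
        + ENNReal.ofReal (af (min ε' (1 / 2)))
        + ENNReal.ofReal ((1 - κ) * af ((∑' i, max (p i - ε') 0) / (1 - κ))) := by
  classical
  have hp0 := (hP0 hp).1
  have hps := (hP0 hp).2.1
  have hp1 := (hP0 hp).2.2
  have hq0 := (hP0 hq).1
  have hqs := (hP0 hq).2.1
  have hq1 := (hP0 hq).2.2
  set P : (Fin n → ℕ) → ℝ := fun i => if η < p i then p i else 0 with hP
  set E : (Fin n → ℕ) → ℝ := fun i => if η < p i then 0 else p i with hE
  have hPE : ∀ i, p i = P i + E i := fun i => by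
    simp only [hP, hE]; split_ifs <;> simp
  have hPC : P ∈ coneOf P0 := hconea (fun x => if η < x then x else 0) fun x hx => by
    split_ifs <;> simp [hx]
  have hEC : E ∈ coneOf P0 := hconea (fun x => if η < x then 0 else x) fun x hx => by
    split_ifs <;> simp [hx]
  have hPs := coneOf_summable hP0 hPC
  have hEs := coneOf_summable hP0 hEC
  have hPnn := coneOf_nonneg hP0 hPC
  have hEnn := coneOf_nonneg hP0 hEC
  have hκ0 : 0 ≤ κ := hκ ▸ tsum_nonneg hEnn
  have hκ1 : κ < 1 := by linarith
  have hεε' : ε ≤ ε' := by linarith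
  have hε'0 : 0 < ε' := by linarith
  have hPsum : ∑' i, P i = 1 - κ := by
    have : ∑' i, p i = ∑' i, P i + ∑' i, E i := by
      rw [← hPs.tsum_add hEs]
      exact tsum_congr hPE
    rw [hp1, ← hκ] at this
    linarith
  set Q : (Fin n → ℕ) → ℝ := (1 - κ) • q with hQ
  have hQC : Q ∈ coneOf P0 := coneOf_smul (by linarith) (subset_coneOf hq)
  have hQs := coneOf_summable hP0 hQC
  have hQsum : ∑' i, Q i = 1 - κ := by
    simp [hQ, tsum_mul_left, hq1]
  have hQE : Q + E ∈ P0 := mem_of_mem_coneOf hP0 (coneOf_add hconv hQC hEC) (by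
    rw [show ∑' i, (Q + E) i = ∑' i, Q i + ∑' i, E i from hQs.tsum_add hEs, hQsum, ← hκ]
    ring)
  set t : (Fin n → ℕ) → ℝ := fun i => max (P i - Q i) 0 with ht
  set s : (Fin n → ℕ) → ℝ := fun i => max (Q i - P i) 0 with hs
  have htC : t ∈ coneOf P0 := by
    convert (hparts _ hQE).1 using 2 with i
    rw [ht, hPE i, Pi.add_apply]
    ring_nf
  have hsC : s ∈ coneOf P0 := by
    convert (hparts _ hQE).2 using 2 with i
    rw [hs, hPE i, Pi.add_apply]
    ring_nf
  have hts := coneOf_summable hP0 htC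
  have hss := coneOf_summable hP0 hsC
  have htnn := coneOf_nonneg hP0 htC
  have hQnn := coneOf_nonneg hP0 hQC
  have hst : ∀ i, s i + P i = t i + Q i := fun i => by
    simp only [hs, ht]
    rcases le_total (P i) (Q i) with h | h
    · rw [max_eq_left (sub_nonneg.2 h), max_eq_right (sub_nonpos.2 h)]; ring
    · rw [max_eq_right (sub_nonpos.2 h), max_eq_left (sub_nonneg.2 h)]; ring
  have hssum : ∑' i, s i = ∑' i, t i := by
    have : ∑' i, (s i + P i) = ∑' i, (t i + Q i) := tsum_congr hst
    rw [hss.tsum_add hPs, hts.tsum_add hQs, hPsum, hQsum] at this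
    linarith
  have htP : ∀ i, t i ≤ P i := fun i => max_le (by linarith [hQnn i]) (hPnn i)
  have htsum0 : 0 ≤ ∑' i, t i := tsum_nonneg htnn
  have htsum1 : ∑' i, t i ≤ 1 - κ := hPsum ▸ hts.tsum_le_tsum htP hPs
  have htsumε : ∑' i, t i ≤ ε' := by
    have hms : Summable fun i => max (p i - q i) 0 := coneOf_summable hP0 (hparts q hq).1
    have : ∑' i, t i ≤ ∑' i, (max (p i - q i) 0 + κ * q i) :=
      hts.tsum_le_tsum (fun i => by
        refine max_le ?_ (add_nonneg (le_max_right _ _) (mul_nonneg hκ0 (hq0 i)))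
        have h1 := le_max_left (p i - q i) 0
        have h2 := hPE i
        have h3 := hEnn i
        simp only [hQ, Pi.smul_apply, smul_eq_mul]
        linarith) (hms.add (hqs.mul_left κ))
    rw [hms.tsum_add (hqs.mul_left κ), tsum_max_sub_zero_eq_TV (hP0 hp) (hP0 hq),
      tsum_mul_left, hq1] at this
    linarith
  have htε : ∀ i, t i ≤ ε' := fun i => (hts.le_tsum i fun j _ => htnn j).trans htsumε
  -- comparison of `P + s` with `Q + t`
  set u : (Fin n → ℕ) → ℝ := fun i => max (p i - ε') 0 with hu
  set m : (Fin n → ℕ) → ℝ := fun i => if η < p i then min (p i) ε' else 0 with hm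
  have huC : u ∈ coneOf P0 := hconea (fun x => max (x - ε') 0) fun x hx =>
    ⟨le_max_right _ _, max_le (by linarith) hx⟩
  have hmC : m ∈ coneOf P0 := hconea (fun x => if η < x then min x ε' else 0) fun x hx => by
    split_ifs
    · exact ⟨le_min hx hε'0.le, min_le_left _ _⟩
    · exact ⟨le_rfl, hx⟩
  have hum : ∀ i, u i + m i = P i := fun i => by
    simp only [hu, hm, hP]
    split_ifs with h
    · rcases le_total (p i) ε' with h | h
      · rw [max_eq_right (by linarith), min_eq_left h, zero_add]
      · rw [max_eq_left (by linarith), min_eq_right h]; ring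
    · rw [max_eq_right (by linarith), add_zero]
  have huE : ∀ i, ¬ η < p i → u i = 0 := fun i hi => max_eq_right (by linarith)
  have htm : ∀ i, t i ≤ m i := fun i => by
    have h1 := htP i
    have h2 := htε i
    simp only [hm]
    simp only [hP] at h1
    split_ifs at h1 ⊢
    · exact le_min h1 h2
    · exact h1
  have hgC : (fun i => m i - t i) ∈ coneOf P0 := by
    have hsub := sub_mem_coneOf_of_finite_ratio hP0 hconv hp hparts
      (coneOf_add hconv (coneOf_add hconv huC htC) hEC) (fun i => by
        simp only [Pi.add_apply]
        linarith [htm i, hum i, hPE i]) (by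
        refine (((finite_setOf_lt_of_summable hps hη).image
          fun i => (u + t + E) i / p i).union (Set.toFinite {0, 1})).subset ?_
        rintro _ ⟨i, rfl⟩
        by_cases hi : η < p i
        · exact Or.inl ⟨i, hi, rfl⟩
        · have h1 : t i = 0 := le_antisymm (by simpa [hP, hi] using htP i) (htnn i)
          have h2 : E i = p i := by simp [hE, hi]
          simp only [Pi.add_apply, huE i hi, h1, h2, add_zero, zero_add]
          right
          rcases eq_or_ne (p i) 0 with h | h <;> simp [h])
    convert hsub using 2 with i
    simp only [Pi.add_apply]
    linarith [hum i, hPE i]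
  have hms := coneOf_summable hP0 hmC
  have hus := coneOf_summable hP0 huC
  have hmsum : ∑' i, m i ≤ 1 - κ := by
    rw [← hPsum]
    exact hms.tsum_le_tsum (fun i => by linarith [hum i, coneOf_nonneg hP0 huC i]) hPs
  have htmsum : ∑' i, t i ≤ ∑' i, m i := hts.tsum_le_tsum htm hms
  set δ := ∑' i, t i with hδ
  have e1 := ftilde_add_lower hP0 hconv hlow hsC hPC
  have e2 := ftilde_add_upper hP0 hconv hup htC hQC
  have e3 := ftilde_add_lower hP0 hconv hlow huC hmC
  have e4 := ftilde_add_lower hP0 hconv hlow htC hgC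
  rw [hss.tsum_add hPs, hssum, hPsum, show s + P = t + Q from funext hst] at e1
  rw [hts.tsum_add hQs, hQsum, ← hδ] at e2
  rw [tsum_congr hum, hPsum, show u + m = P from funext hum] at e3
  rw [show (t + fun i => m i - t i) = m from funext fun i => add_sub_cancel _ _,
    tsum_congr fun i => add_sub_cancel (t i) (m i), ← hδ] at e4
  have hFQ : ftilde f Q ≤ f q := by
    rw [hQ, ftilde_smul f (by linarith), ftilde_of_mem hP0 f hq]
    exact mul_le_of_le_one_left zero_le (ENNReal.ofReal_le_one.2 (by linarith))
  have hD : ENNReal.ofReal ((δ + (1 - κ)) * af (δ / (δ + (1 - κ)))) +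
      ENNReal.ofReal ((δ + (1 - κ)) * bf (δ / (δ + (1 - κ)))) ≤
      ENNReal.ofReal ((1 + ε') * (af (ε' / (1 + ε')) + bf (ε' / (1 + ε')))) := by
    have hM : 0 < δ + (1 - κ) := by linarith
    have hl : δ / (δ + (1 - κ)) ∈ Set.Icc (0 : ℝ) 1 :=
      ⟨by positivity, by rw [div_le_one hM]; linarith⟩
    have key : ∀ g : ℝ → ℝ, g 0 = 0 → (∀ l ∈ Set.Icc (0 : ℝ) 1, g l = g (1 - l)) →
        ConcaveOn ℝ (Set.Icc 0 (1 / 2)) g → MonotoneOn g (Set.Icc 0 (1 / 2)) →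
        (δ + (1 - κ)) * g (δ / (δ + (1 - κ))) ≤ (1 + ε') * g (ε' / (1 + ε')) := by
      intro g g0 gsym gconc gmono
      refine (errorFun_perspective_mono (N := 1 + ε') g0 gsym gconc gmono htsum0 (by linarith)
        (by linarith) (by linarith) (by linarith)).trans ?_
      refine mul_le_mul_of_nonneg_left (gmono ⟨by positivity, ?_⟩ ⟨by positivity, ?_⟩ ?_)
        (by linarith)
      · rw [div_le_iff₀ (by linarith)]; linarith
      · rw [div_le_iff₀ (by linarith)]; linarith
      · gcongr
    rw [← ENNReal.ofReal_add (mul_nonneg hM.le (errorFun_nonneg haf0 haf_sym haf_mono hl))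
      (mul_nonneg hM.le (errorFun_nonneg hbf0 hbf_sym hbf_mono hl)), mul_add]
    exact ENNReal.ofReal_le_ofReal (add_le_add (key af haf0 haf_sym haf_conc haf_mono)
      (key bf hbf0 hbf_sym hbf_conc hbf_mono))
  have hA : ENNReal.ofReal ((∑' i, m i) * af (δ / ∑' i, m i)) ≤
      ENNReal.ofReal (af (min ε' (1 / 2))) :=
    ENNReal.ofReal_le_ofReal (mul_errorFun_div_le haf0 haf_sym haf_conc haf_mono htsum0 htmsum
      (by linarith) htsumε)
  have htfin : ftilde f t ≠ ∞ := by
    have h3 := le_add_self.trans e3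
    have h4 := le_self_add.trans e4
    exact ne_top_of_le_ne_top (by finiteness) (h4.trans (add_le_add_left h3 _))
  refine (ENNReal.add_le_add_iff_right htfin).1 ?_
  generalize ENNReal.ofReal ((1 + ε') * (af (ε' / (1 + ε')) + bf (ε' / (1 + ε')))) = D at *
  calc ftilde f u + ftilde f t
      ≤ ftilde f u + (ftilde f m + ENNReal.ofReal ((∑' i, m i) * af (δ / ∑' i, m i))) := by
        gcongr
        exact le_self_add.trans e4
    _ ≤ (ftilde f u + ftilde f m) + ENNReal.ofReal (af (min ε' (1 / 2))) := by
        rw [add_assoc]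
        gcongr
    _ ≤ ftilde f P + ENNReal.ofReal ((1 - κ) * af ((∑' i, u i) / (1 - κ)))
        + ENNReal.ofReal (af (min ε' (1 / 2))) := by
        gcongr
    _ ≤ (f q + ftilde f t + D) + ENNReal.ofReal ((1 - κ) * af ((∑' i, u i) / (1 - κ)))
        + ENNReal.ofReal (af (min ε' (1 / 2))) := by
        gcongr
        calc ftilde f P ≤ ftilde f t + ftilde f Q + ENNReal.ofReal _ + ENNReal.ofReal _ :=
              (le_add_self.trans e1).trans (add_le_add_left e2 _)
          _ ≤ ftilde f t + f q + D := by
              rw [add_assoc (ftilde f t + ftilde f Q), add_comm (ENNReal.ofReal _)]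
              gcongr
          _ = f q + ftilde f t + D := by rw [add_comm (f q)]
    _ = _ := by ring

end Truncation
/-- Lemma 2B of the paper, classical version: local lower bound
`f(q̄) ≥ f̃([p̄−ε]₊) − D_f(ε) − ã_f(ε) − a_f(1−r_ε)` for a locally almost affine
nonnegative function `f` on a convex subset `P₀` of the set of `n`-variate probability
distributions, stated in `[0,+∞]` as
`f̃([p̄−ε]₊) ≤ f(q̄) + D_f(ε) + ã_f(ε) + a_f(1−r_ε)`. -/
theorem LAA_local_lower_bound_B {n : ℕ}
    (P0 : Set ((Fin n → ℕ) → ℝ)) (hP0 : P0 ⊆ distrSet n) (hP0conv : Convex ℝ P0)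
    (f : ((Fin n → ℕ) → ℝ) → ℝ≥0∞) (af bf : ℝ → ℝ)
    (haf_cont : ContinuousOn af (Set.Icc 0 1)) (hbf_cont : ContinuousOn bf (Set.Icc 0 1))
    (haf0 : af 0 = 0) (hbf0 : bf 0 = 0)
    (haf_sym : ∀ l ∈ Set.Icc (0 : ℝ) 1, af l = af (1 - l))
    (hbf_sym : ∀ l ∈ Set.Icc (0 : ℝ) 1, bf l = bf (1 - l))
    (haf_conc : ConcaveOn ℝ (Set.Icc 0 (1 / 2)) af)
    (hbf_conc : ConcaveOn ℝ (Set.Icc 0 (1 / 2)) bf)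
    (haf_mono : MonotoneOn af (Set.Icc 0 (1 / 2)))
    (hbf_mono : MonotoneOn bf (Set.Icc 0 (1 / 2)))
    (hlow : ∀ p ∈ P0, ∀ q ∈ P0, ∀ l ∈ Set.Icc (0 : ℝ) 1,
      ENNReal.ofReal l * f p + ENNReal.ofReal (1 - l) * f q
        ≤ f (l • p + (1 - l) • q) + ENNReal.ofReal (af l))
    (hup : ∀ p ∈ P0, ∀ q ∈ P0, ∀ l ∈ Set.Icc (0 : ℝ) 1,
      f (l • p + (1 - l) • q)
        ≤ ENNReal.ofReal l * f p + ENNReal.ofReal (1 - l) * f q + ENNReal.ofReal (bf l))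
    (p : (Fin n → ℕ) → ℝ) (hp : p ∈ P0)
    (hconea : ∀ h : ℝ → ℝ, (∀ x : ℝ, 0 ≤ x → 0 ≤ h x ∧ h x ≤ x) →
      (fun i => h (p i)) ∈ coneOf P0)
    (hconeb : ∀ q ∈ P0, q ≠ p →
      (fun i => max (p i - q i) 0) ∈ coneOf P0 ∧ (fun i => max (q i - p i) 0) ∈ coneOf P0)
    (hfin : f p ≠ ∞ ∨
      ∀ ε ∈ Set.Ioc (0 : ℝ) 1, ftilde f (fun i => max (p i - ε) 0) ≠ ∞)
    (ε : ℝ) (hε : ε ∈ Set.Ioc (0 : ℝ) 1)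
    (q : (Fin n → ℕ) → ℝ) (hq : q ∈ P0) (hTV : TV p q ≤ ε) :
    ftilde f (fun i => max (p i - ε) 0)
      ≤ f q
        + ENNReal.ofReal ((1 + ε) * (af (ε / (1 + ε)) + bf (ε / (1 + ε))))
        + ENNReal.ofReal (if ε ≤ 1 / 2 then af ε else af (1 / 2))
        + ENNReal.ofReal (af (1 - ∑' i, max (p i - ε) 0)) := by
  classical
  obtain ⟨hε0, hε1⟩ := hε
  have hp0 := (hP0 hp).1
  have hps := (hP0 hp).2.1
  have hp1 := (hP0 hp).2.2
  have hparts : ∀ q ∈ P0, (fun i => max (p i - q i) 0) ∈ coneOf P0 ∧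
      (fun i => max (q i - p i) 0) ∈ coneOf P0 := fun q hq => by
    by_cases h : q = p
    · subst h
      have : (fun _ => 0 : (Fin n → ℕ) → ℝ) ∈ coneOf P0 := ⟨0, le_rfl, q, hq, by ext; simp⟩
      simpa using this
    · exact hconeb q hq h
  -- finiteness of the extension at all truncations of `p`
  have hufin : ∀ η ∈ Set.Ioc (0 : ℝ) 1, ftilde f (fun i => max (p i - η) 0) ≠ ∞ := by
    rcases hfin with h | h
    · intro η hη
      have := ftilde_truncation_le (h := fun x => max (x - η) 0) (k := fun x => x) hP0 hP0conv
        haf_sym haf_mono hlow hconea (fun x _ => le_max_right _ _)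
        (fun x hx => max_le (by linarith [hη.1]) hx) (fun x _ => le_rfl)
      refine ne_top_of_le_ne_top ?_ this
      rw [show (fun i => p i) = p from rfl, ftilde_of_mem hP0 f hp]
      finiteness
    · exact h
  have hPfin : ∀ η ∈ Set.Ioc (0 : ℝ) 1, ftilde f (fun i => if η < p i then p i else 0) ≠ ∞ := by
    intro η hη
    have := ftilde_truncation_le (h := fun x => (1 / 2) * if η < x then x else 0)
      (k := fun x => max (x - η / 2) 0) hP0 hP0conv
      haf_sym haf_mono hlow hconea (fun x hx => by split_ifs <;> simp [hx])
      (fun x hx => by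
        split_ifs
        · exact le_max_of_le_left (by linarith)
        · simp) (fun x hx => max_le (by linarith [hη.1]) hx)
    have h2 := hufin (η / 2) ⟨by linarith [hη.1], by linarith [hη.1, hη.2]⟩
    have h3 := ne_top_of_le_ne_top (by finiteness) this
    have e : (fun i => if η < p i then p i else 0) =
        (2 : ℝ) • fun i => (1 / 2) * if η < p i then p i else 0 := by
      ext i
      simp
    rw [e, ftilde_smul f (by norm_num)]
    finiteness
  set u : (Fin n → ℕ) → ℝ := fun i => max (p i - ε) 0 with hu
  have hsumm : ∀ e, 0 ≤ e → Summable fun i => max (p i - e) 0 := fun e he =>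
    hps.of_nonneg_of_le (fun i => le_max_right _ _) fun i => max_le (by linarith) (hp0 i)
  have hex : ∀ e, 0 ≤ e → (fun i => max (p i - e) 0) ∈ coneOf P0 := fun e he =>
    hconea (fun x => max (x - e) 0) fun x hx => ⟨le_max_right _ _, max_le (by linarith) hx⟩
  set r := ∑' i, u i with hr
  have hus : Summable u := hsumm ε hε0.le
  have hr0 : 0 ≤ r := tsum_nonneg fun i => le_max_right _ _
  have hr1 : r ≤ 1 := hp1 ▸ hus.tsum_le_tsum (fun i => max_le (by linarith) (hp0 i)) hps
  rcases hr0.eq_or_lt with hr00 | hrpos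
  · have : ftilde f u = 0 := by rw [ftilde, ← hr, ← hr00]; simp
    rw [this]
    exact zero_le
  have hε1' : ε < 1 := by
    refine lt_of_le_of_ne hε1 fun h => hrpos.ne' ?_
    have : ∀ i, u i = 0 := fun i => max_eq_right (by
      have := hps.le_tsum i fun j _ => hp0 j
      linarith)
    rw [hr, tsum_congr this, tsum_zero]
  -- truncation levels decreasing to zero
  set η : ℕ → ℝ := fun k => ε * (1 / ((k : ℝ) + 1)) with hη
  have hηpos : ∀ k, 0 < η k := fun k => by simp only [hη]; positivity
  have hηle : ∀ k, η k ≤ ε := fun k =>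
    mul_le_of_le_one_right hε0.le (div_le_one_of_le₀ (by simp) (by positivity))
  have hηlim : Filter.Tendsto η Filter.atTop (nhds 0) := by
    have := (tendsto_one_div_add_atTop_nhds_zero_nat (𝕜 := ℝ)).const_mul ε
    rw [mul_zero] at this
    exact this
  set κ : ℕ → ℝ := fun k => ∑' i, if η k < p i then 0 else p i with hκ
  have hκ0 : ∀ k, 0 ≤ κ k := fun k => tsum_nonneg fun i => by
    split_ifs
    · exact le_rfl
    · exact hp0 i
  have hκlim : Filter.Tendsto κ Filter.atTop (nhds 0) := by
    have := tendsto_tsum_of_dominated_convergence (𝓕 := Filter.atTop)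
      (f := fun k i => if η k < p i then 0 else p i) (g := fun _ => 0) hps
      (fun i => squeeze_zero (fun k => by
          split_ifs
          · exact le_rfl
          · exact hp0 i) (fun k => by
          split_ifs with h
          · exact (hηpos k).le
          · exact not_lt.1 h) hηlim)
      (Filter.Eventually.of_forall fun k i => by
        rw [Real.norm_eq_abs]
        split_ifs
        · simpa using hp0 i
        · rw [abs_of_nonneg (hp0 i)])
    simpa using this
  have hε'lim : Filter.Tendsto (fun k => ε + κ k) Filter.atTop (nhds ε) := by
    simpa using hκlim.const_add ε
  set r' : ℕ → ℝ := fun k => ∑' i, max (p i - (ε + κ k)) 0 with hr'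
  have hr'lim : Filter.Tendsto r' Filter.atTop (nhds r) :=
    tendsto_tsum_of_dominated_convergence (𝓕 := Filter.atTop) hps
      (fun i => (hε'lim.const_sub (p i)).max tendsto_const_nhds)
      (Filter.Eventually.of_forall fun k i => by
        rw [Real.norm_eq_abs, abs_of_nonneg (le_max_right _ _)]
        exact max_le (by linarith [hκ0 k]) (hp0 i))
  have hr'0 : ∀ k, 0 ≤ r' k := fun k => tsum_nonneg fun i => le_max_right _ _
  have hr'r : ∀ k, r' k ≤ r := fun k =>
    (hsumm _ (by linarith [hκ0 k])).tsum_le_tsum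
      (fun i => max_le_max_right _ (by linarith [hκ0 k])) hus
  have hr'κ : ∀ k, r' k ≤ 1 - κ k := fun k => by
    have h1 : Summable fun i => if η k < p i then 0 else p i :=
      hps.of_nonneg_of_le (fun i => by split_ifs <;> simp [hp0 i])
        (fun i => by split_ifs <;> simp [hp0 i])
    have h2 := hsumm (ε + κ k) (by linarith [hκ0 k])
    have h3 := (h2.add h1).tsum_le_tsum (g := p) (fun i => by
      split_ifs with h
      · rw [add_zero]
        exact max_le (by linarith [hκ0 k]) (hp0 i)
      · rw [max_eq_right (by linarith [hκ0 k, hηle k]), zero_add]) hps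
    rw [h2.tsum_add h1, hp1] at h3
    linarith
  set K := ftilde f (fun i => max (p i - ε / 2) 0) with hK
  have hKfin : K ≠ ∞ := hufin _ ⟨by linarith, by linarith⟩
  set A := ENNReal.ofReal ((∑' i, max (p i - ε / 2) 0) * af (1 / 2)) with hA
  -- the estimate at each truncation level
  have hev : ∀ᶠ k in Filter.atTop, ftilde f u ≤
      f q + ENNReal.ofReal ((1 + (ε + κ k)) *
          (af ((ε + κ k) / (1 + (ε + κ k))) + bf ((ε + κ k) / (1 + (ε + κ k)))))
        + ENNReal.ofReal (af (min (ε + κ k) (1 / 2)))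
        + ENNReal.ofReal ((1 - κ k) * af (r' k / (1 - κ k)))
        + ENNReal.ofReal (2 / ε) * (ENNReal.ofReal (κ k) * (K + A))
        + ENNReal.ofReal (r * bf (r' k / r)) := by
    filter_upwards [hε'lim.eventually (ge_mem_nhds hε1')] with k hk
    have h1 := ftilde_excess_le_of_truncation hP0 hP0conv haf0 hbf0 haf_sym hbf_sym haf_conc
      hbf_conc haf_mono hbf_mono hlow hup hp hconea hparts hε0 (hηpos k) (hηle k) hq hTV
      (hPfin _ ⟨hηpos k, (hηle k).trans hε1⟩) (κ := κ k) rfl rfl hk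
    have hκk := hκ0 k
    have hκ1 : κ k ≤ 1 := by linarith
    set d : (Fin n → ℕ) → ℝ := fun i => max (p i - ε) 0 - max (p i - (ε + κ k)) 0 with hd
    have hdle : ∀ x : ℝ, max (x - ε) 0 - max (x - (ε + κ k)) 0 ≤ κ k := fun x => by
      have := le_max_left (x - (ε + κ k)) 0
      have h2 := le_max_right (x - (ε + κ k)) 0
      rw [sub_le_iff_le_add]
      exact max_le (by linarith) (by linarith)
    have hd0 : ∀ x : ℝ, 0 ≤ max (x - ε) 0 - max (x - (ε + κ k)) 0 := fun x =>
      sub_nonneg.2 (max_le_max_right _ (by linarith))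
    have hdC : d ∈ coneOf P0 :=
      hconea (fun x => max (x - ε) 0 - max (x - (ε + κ k)) 0) fun x hx => ⟨hd0 x, by
        have h2 := le_max_right (x - (ε + κ k)) 0
        have : max (x - ε) 0 ≤ x := max_le (by linarith) hx
        linarith⟩
    have h2 := ftilde_add_upper hP0 hP0conv hup (hex (ε + κ k) (by linarith)) hdC
    have e : (fun i => max (p i - (ε + κ k)) 0) + d = u :=
      funext fun i => add_sub_cancel _ _
    have e' : ∑' i, (max (p i - (ε + κ k)) 0 + d i) = r :=
      tsum_congr fun i => add_sub_cancel _ _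
    rw [e, e'] at h2
    have h3 : ftilde f d ≤ ENNReal.ofReal (2 / ε) * (ENNReal.ofReal (κ k) * (K + A)) := by
      have h4 := ftilde_truncation_le
        (h := fun x => (ε / 2) * (max (x - ε) 0 - max (x - (ε + κ k)) 0))
        (k := fun x => κ k * max (x - ε / 2) 0) hP0 hP0conv haf_sym haf_mono hlow hconea
        (fun x hx => mul_nonneg (by linarith) (hd0 x)) (fun x hx => by
          rcases le_total x ε with h | h
          · rw [max_eq_right (sub_nonpos.2 h),
              max_eq_right (by linarith : x - (ε + κ k) ≤ 0), sub_zero, mul_zero]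
            exact mul_nonneg hκk (le_max_right _ _)
          · calc _ ≤ (ε / 2) * κ k := mul_le_mul_of_nonneg_left (hdle x) (by linarith)
              _ = κ k * (ε / 2) := mul_comm _ _
              _ ≤ _ := mul_le_mul_of_nonneg_left (le_max_of_le_left (by linarith)) hκk)
        (fun x hx => (mul_le_of_le_one_left (le_max_right _ _) hκ1).trans
          (max_le (by linarith) hx))
      have e1 : (fun i => κ k * max (p i - ε / 2) 0) =
          κ k • fun i => max (p i - ε / 2) 0 := rfl
      have e2 : d = (2 / ε) • fun i =>
          (ε / 2) * (max (p i - ε) 0 - max (p i - (ε + κ k)) 0) := by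
        ext i
        simp only [hd, Pi.smul_apply, smul_eq_mul]
        field_simp
      rw [tsum_mul_left, e1, ftilde_smul f hκk, mul_assoc (κ k), ENNReal.ofReal_mul hκk,
        ← mul_add] at h4
      rw [e2, ftilde_smul f (by positivity)]
      exact mul_le_mul_right h4 _
    exact h2.trans (add_le_add_left (add_le_add h1 h3) _)
  refine ge_of_tendsto ?_ hev
  -- the limit of the right-hand sides
  have hcomp : ∀ (g : ℝ → ℝ), ContinuousOn g (Set.Icc 0 1) → ∀ (x : ℕ → ℝ) (l : ℝ),
      l ∈ Set.Icc (0 : ℝ) 1 → (∀ᶠ k in Filter.atTop, x k ∈ Set.Icc (0 : ℝ) 1) →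
      Filter.Tendsto x Filter.atTop (nhds l) →
      Filter.Tendsto (fun k => g (x k)) Filter.atTop (nhds (g l)) :=
    fun g hg x l hl hx hlim => (hg l hl).tendsto.comp (tendsto_nhdsWithin_iff.2 ⟨hlim, hx⟩)
  have hratio : Filter.Tendsto (fun k => (ε + κ k) / (1 + (ε + κ k))) Filter.atTop
      (nhds (ε / (1 + ε))) := hε'lim.div (hε'lim.const_add 1) (by linarith)
  have hratio_mem : ∀ e : ℝ, 0 ≤ e → e / (1 + e) ∈ Set.Icc (0 : ℝ) 1 := fun e he =>
    ⟨by positivity, div_le_one_of_le₀ (by linarith) (by linarith)⟩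
  have hratio_ev : ∀ᶠ k in Filter.atTop,
      (ε + κ k) / (1 + (ε + κ k)) ∈ Set.Icc (0 : ℝ) 1 :=
    Filter.Eventually.of_forall fun k => hratio_mem _ (by linarith [hκ0 k])
  have t1 : Filter.Tendsto (fun k => ENNReal.ofReal ((1 + (ε + κ k)) *
      (af ((ε + κ k) / (1 + (ε + κ k))) + bf ((ε + κ k) / (1 + (ε + κ k)))))) Filter.atTop
      (nhds (ENNReal.ofReal ((1 + ε) * (af (ε / (1 + ε)) + bf (ε / (1 + ε)))))) :=
    ENNReal.tendsto_ofReal ((hε'lim.const_add 1).mul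
      ((hcomp af haf_cont _ _ (hratio_mem ε hε0.le) hratio_ev hratio).add
        (hcomp bf hbf_cont _ _ (hratio_mem ε hε0.le) hratio_ev hratio)))
  have hmin_mem : ∀ e : ℝ, 0 ≤ e → min e (1 / 2) ∈ Set.Icc (0 : ℝ) 1 := fun e he =>
    ⟨le_min he (by norm_num), (min_le_right _ _).trans (by norm_num)⟩
  have t2 : Filter.Tendsto (fun k => ENNReal.ofReal (af (min (ε + κ k) (1 / 2)))) Filter.atTop
      (nhds (ENNReal.ofReal (if ε ≤ 1 / 2 then af ε else af (1 / 2)))) := by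
    have e : (if ε ≤ 1 / 2 then af ε else af (1 / 2)) = af (min ε (1 / 2)) := by
      rw [min_def, apply_ite af]
    rw [e]
    exact ENNReal.tendsto_ofReal (hcomp af haf_cont _ _ (hmin_mem ε hε0.le)
      (Filter.Eventually.of_forall fun k => hmin_mem _ (by linarith [hκ0 k]))
      (hε'lim.min tendsto_const_nhds))
  have hκ1lim : Filter.Tendsto (fun k => 1 - κ k) Filter.atTop (nhds 1) := by
    simpa using hκlim.const_sub 1
  have t3 : Filter.Tendsto (fun k => ENNReal.ofReal ((1 - κ k) * af (r' k / (1 - κ k))))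
      Filter.atTop (nhds (ENNReal.ofReal (af (1 - r)))) := by
    rw [← haf_sym r ⟨hr0, hr1⟩]
    have h1 : Filter.Tendsto (fun k => r' k / (1 - κ k)) Filter.atTop (nhds r) := by
      have := hr'lim.div hκ1lim one_ne_zero
      rw [div_one] at this
      exact this
    refine ENNReal.tendsto_ofReal ?_
    simpa using hκ1lim.mul (hcomp af haf_cont (fun k => r' k / (1 - κ k)) r ⟨hr0, hr1⟩
      (Filter.Eventually.of_forall fun k => ⟨div_nonneg (hr'0 k) ((hr'0 k).trans (hr'κ k)),
        div_le_one_of_le₀ (hr'κ k) ((hr'0 k).trans (hr'κ k))⟩)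
      h1)
  have t4 : Filter.Tendsto
      (fun k => ENNReal.ofReal (2 / ε) * (ENNReal.ofReal (κ k) * (K + A)))
      Filter.atTop (nhds 0) := by
    have h1 : Filter.Tendsto (fun k => ENNReal.ofReal (κ k)) Filter.atTop (nhds 0) := by
      simpa using ENNReal.tendsto_ofReal hκlim
    have h2 := ENNReal.Tendsto.mul_const (b := K + A) h1 (Or.inr (by finiteness))
    simpa using ENNReal.Tendsto.const_mul (a := ENNReal.ofReal (2 / ε)) h2
      (Or.inr ENNReal.ofReal_ne_top)
  have t5 : Filter.Tendsto (fun k => ENNReal.ofReal (r * bf (r' k / r)))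
      Filter.atTop (nhds 0) := by
    have hb1 : bf 1 = 0 := by
      rw [hbf_sym 1 ⟨zero_le_one, le_rfl⟩, sub_self, hbf0]
    have h1 : Filter.Tendsto (fun k => r' k / r) Filter.atTop (nhds 1) := by
      simpa [hrpos.ne'] using hr'lim.div_const r
    have h2 := (hcomp bf hbf_cont _ 1 ⟨zero_le_one, le_rfl⟩
      (Filter.Eventually.of_forall fun k => ⟨div_nonneg (hr'0 k) hr0,
        div_le_one_of_le₀ (hr'r k) hr0⟩) h1).const_mul r
    simpa [hb1] using ENNReal.tendsto_ofReal h2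
  simpa using ((((tendsto_const_nhds (x := f q)).add t1).add t2).add t3).add t4 |>.add t5
end

section
/- Let p̄ = (p_i) be a summable family of nonnegative reals with ∑_i p_i ≤ 1 and let ε ∈ (0, ∑_i p_i). Then H̃([p̄−ε]₊) ≥ ∑_{i ∈ I_ε} η(p_i) − η(∑_{i ∈ I_ε} p_i) − ε·|I_ε|·ln|I_ε| − h₂(ε·|I_ε|), where I_ε is the (finite) set of all i such that p_i > ε and |I_ε| is its cardinality. -/
/-- The binary entropy `h₂(x) = η(x) + η(1−x)`, where `η(x) = −x·ln x`. -/
noncomputable def binEnt (x : ℝ) : ℝ := Real.negMulLog x + Real.negMulLog (1 - x)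

theorem negMulLog_add_le {x y : ℝ} (hx : 0 < x) (hy : 0 < y) :
    Real.negMulLog (x + y) ≤ Real.negMulLog x + Real.negMulLog y := by
  have h1 : Real.log x ≤ Real.log (x + y) := Real.log_le_log hx (by linarith)
  have h2 : Real.log y ≤ Real.log (x + y) := Real.log_le_log hy (by linarith)
  simp only [Real.negMulLog]
  nlinarith [mul_le_mul_of_nonneg_left h1 hx.le, mul_le_mul_of_nonneg_left h2 hy.le]

/-- By concavity, the decrement `η(x - t) - η(x)` is at most its value at `x = 1`. -/
theorem negMulLog_sub_le {x t : ℝ} (ht : 0 < t) (htx : t ≤ x) (hx : x ≤ 1) :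
    Real.negMulLog (x - t) - Real.negMulLog x ≤ Real.negMulLog (1 - t) := by
  have hd : 0 < 1 - (x - t) := by linarith
  have hc := Real.concaveOn_negMulLog
  have hm : x - t ∈ Set.Ici (0 : ℝ) := by simpa using htx
  have h1 : (1 : ℝ) ∈ Set.Ici (0 : ℝ) := by simp
  have hw : 0 ≤ (1 - x) / (1 - (x - t)) := div_nonneg (by linarith) hd.le
  have hv : 0 ≤ t / (1 - (x - t)) := div_nonneg ht.le hd.le
  have hs : (1 - x) / (1 - (x - t)) + t / (1 - (x - t)) = 1 := by
    rw [← add_div, div_eq_one_iff_eq hd.ne']; ring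
  have e1 := hc.2 hm h1 hw hv hs
  have e2 := hc.2 hm h1 hv hw (by rw [add_comm]; exact hs)
  simp only [smul_eq_mul, Real.negMulLog_one, mul_zero, add_zero, mul_one] at e1 e2
  have f1 : (1 - x) / (1 - (x - t)) * (x - t) + t / (1 - (x - t)) = x := by
    rw [div_mul_eq_mul_div, ← add_div, div_eq_iff hd.ne']; ring
  have f2 : t / (1 - (x - t)) * (x - t) + (1 - x) / (1 - (x - t)) = 1 - t := by
    rw [div_mul_eq_mul_div, ← add_div, div_eq_iff hd.ne']; ring
  rw [f1] at e1
  rw [f2] at e2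
  have key := congrArg (· * Real.negMulLog (x - t)) hs
  simp only [add_mul, one_mul] at key
  linarith

/-- The lower bound for a finite family all of whose members exceed `ε`. -/
theorem sum_negMulLog_sub_lower_bound {ι : Type*} (S : Finset ι) (p : ι → ℝ) {ε : ℝ}
    (hε0 : 0 < ε) (hS : ∀ i ∈ S, ε < p i) (hp1 : ∑ i ∈ S, p i ≤ 1) :
    ∑ i ∈ S, Real.negMulLog (p i) - Real.negMulLog (∑ i ∈ S, p i)
        - ε * (S.card : ℝ) * Real.log (S.card : ℝ) - binEnt (ε * (S.card : ℝ))
      ≤ ∑ i ∈ S, Real.negMulLog (p i - ε) - Real.negMulLog (∑ i ∈ S, (p i - ε)) := by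
  rcases S.eq_empty_or_nonempty with rfl | hne
  · simp [binEnt]
  have hn : (0 : ℝ) < S.card := by exact_mod_cast hne.card_pos
  have hsum : ∑ i ∈ S, (p i - ε) = ∑ i ∈ S, p i - ε * S.card := by
    rw [Finset.sum_sub_distrib, Finset.sum_const, nsmul_eq_mul, mul_comm]
  have hle : ε * S.card ≤ ∑ i ∈ S, p i := by
    have := Finset.sum_nonneg fun i hi => (sub_pos.2 (hS i hi)).le
    linarith
  have hsub : ∑ i ∈ S, Real.negMulLog (p i) ≤
      ∑ i ∈ S, Real.negMulLog (p i - ε) + S.card * Real.negMulLog ε := by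
    rw [← nsmul_eq_mul, ← Finset.sum_const, ← Finset.sum_add_distrib]
    refine Finset.sum_le_sum fun i hi => ?_
    simpa using negMulLog_add_le (sub_pos.2 (hS i hi)) hε0
  have hdec := negMulLog_sub_le (mul_pos hε0 hn) hle hp1
  have hcard : S.card * Real.negMulLog ε =
      Real.negMulLog (ε * S.card) + ε * S.card * Real.log S.card := by
    simp only [Real.negMulLog, Real.log_mul hε0.ne' hn.ne']
    ring
  rw [hsum, binEnt]
  linarith

/-- if `p̄` is a summable family of nonnegative reals with
`∑ᵢ pᵢ ≤ 1` and `ε ∈ (0, ∑ᵢ pᵢ)`, then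
`H̃([p̄−ε]₊) ≥ ∑_{i∈I_ε} η(pᵢ) − η(∑_{i∈I_ε} pᵢ) − ε·|I_ε|·ln|I_ε| − h₂(ε·|I_ε|)`,
where `I_ε = {i | pᵢ > ε}` and `H̃(ā) = ∑ᵢ η(aᵢ) − η(‖ā‖₁)`.
The sums over `I_ε` are expressed as `tsum`s of functions vanishing off `I_ε`,
and `|I_ε| = Nat.card {i // ε < pᵢ}`. -/
theorem shannonEntExt_sub_lower_bound (p : ℕ → ℝ)
    (hp0 : ∀ i, 0 ≤ p i) (hps : Summable p) (hp1 : ∑' i, p i ≤ 1)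
    (ε : ℝ) (hε0 : 0 < ε) (hεlt : ε < ∑' i, p i) :
    (∑' i, if ε < p i then Real.negMulLog (p i) else 0)
        - Real.negMulLog (∑' i, if ε < p i then p i else 0)
        - ε * (Nat.card {i : ℕ // ε < p i} : ℝ)
            * Real.log (Nat.card {i : ℕ // ε < p i} : ℝ)
        - binEnt (ε * (Nat.card {i : ℕ // ε < p i} : ℝ))
      ≤ (∑' i, Real.negMulLog (max (p i - ε) 0))
        - Real.negMulLog (∑' i, max (p i - ε) 0) := by
  have hfin : {i : ℕ | ε < p i}.Finite := by
    have h := hps.tendsto_cofinite_zero.eventually (gt_mem_nhds hε0)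
    refine (Filter.eventually_cofinite.1 h).subset fun i hi => ?_
    exact not_lt.2 (le_of_lt hi)
  have hmem : ∀ i, i ∈ hfin.toFinset ↔ ε < p i := fun i => by simp
  have hcard : Nat.card {i : ℕ // ε < p i} = hfin.toFinset.card :=
    Nat.card_eq_card_finite_toFinset hfin
  have hite : ∀ f : ℕ → ℝ,
      (∑' i, if ε < p i then f i else 0) = ∑ i ∈ hfin.toFinset, f i := fun f => by
    rw [tsum_eq_sum (s := hfin.toFinset) fun i hi => if_neg (mt (hmem i).2 hi)]
    exact Finset.sum_congr rfl fun i hi => if_pos ((hmem i).1 hi)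
  have hmax : ∀ f : ℝ → ℝ, f 0 = 0 →
      ∑' i, f (max (p i - ε) 0) = ∑ i ∈ hfin.toFinset, f (p i - ε) := fun f hf => by
    rw [← hite]
    refine tsum_congr fun i => ?_
    split_ifs with h
    · rw [max_eq_left (sub_pos.2 h).le]
    · rw [max_eq_right (sub_nonpos.2 (not_lt.1 h)), hf]
  rw [hite, hite, hmax _ Real.negMulLog_zero, hmax (fun x => x) rfl, hcard]
  exact sum_negMulLog_sub_lower_bound _ p hε0 (fun i hi => (hmem i).1 hi)
    ((hps.sum_le_tsum _ fun i _ => hp0 i).trans hp1)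
end

section
/- Let p̄ = (p_{ij}) be a joint probability distribution on ℕ×ℕ with H(X₁|X₂)_p̄ < +∞, let ε ∈ (0,1], and let q̄ = (q_{ij}) be any joint probability distribution on ℕ×ℕ with TV(p̄,q̄) ≤ ε. Then H(X₁|X₂)_q̄ ≥ H(X₁|X₂)_p̄ − H̃(X₁|X₂)_{p̄∧ε} − g(ε). -/
open scoped ENNReal

/-- The conditional entropy (equivocation)
`H(X₁|X₂)_p̄ = ∑_{ij} p_{ij}·ln([p̄₂]_j / p_{ij}) ∈ [0,+∞]` (terms with `p_{ij} = 0`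
vanish), where `p̄₂ = (∑ᵢ p_{ij})_j` is the second marginal. -/
noncomputable def condEnt (p : ℕ × ℕ → ℝ) : ℝ≥0∞ :=
  ∑' x : ℕ × ℕ, ENNReal.ofReal (p x * Real.log ((∑' i : ℕ, p (i, x.2)) / p x))

/-- The homogeneous extension `H̃(X₁|X₂)_ā = ‖ā‖₁·H(X₁|X₂)_{ā/‖ā‖₁}`
(equal to `0` at `ā = 0`). -/
noncomputable def condEntExt (a : ℕ × ℕ → ℝ) : ℝ≥0∞ :=
  ENNReal.ofReal (∑' x, a x) * condEnt (fun x => a x / ∑' y, a y)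

/-- `g(x) = (x+1)·ln(x+1) − x·ln x`. -/
noncomputable def gFun (x : ℝ) : ℝ := (x + 1) * Real.log (x + 1) - x * Real.log x

/-- Monotonicity of the perspective `(a, A) ↦ a log (A / a)` along increments `(c, C)` with
`0 ≤ c ≤ C`. -/
lemma mul_log_div_mono {a b A B : ℝ} (ha : 0 ≤ a) (hab : a ≤ b) (haA : a ≤ A)
    (hAB : b - a ≤ B - A) : a * Real.log (A / a) ≤ b * Real.log (B / b) := by
  rcases ha.eq_or_lt with rfl | ha
  · rw [zero_mul]
    rcases hab.eq_or_lt with rfl | hb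
    · simp
    · exact mul_nonneg hb.le (Real.log_nonneg (by rw [le_div_iff₀ hb]; linarith))
  have hb : 0 < b := by linarith
  have hA : 0 < A := by linarith
  have hB : 0 < B := by linarith
  have h1 : Real.log (A / a) - Real.log (B / b) ≤ A * b / (a * B) - 1 := by
    rw [← Real.log_div (by positivity) (by positivity)]
    have h : A / a / (B / b) = A * b / (a * B) := by field_simp
    rw [h]
    exact Real.log_le_sub_one_of_pos (by positivity)
  have h2 : 1 - b / B ≤ Real.log (B / b) := by
    have := Real.one_sub_inv_le_log_of_pos (show 0 < B / b by positivity)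
    rwa [inv_div] at this
  have h3 := mul_le_mul_of_nonneg_left h1 ha.le
  have h4 := mul_le_mul_of_nonneg_left h2 (sub_nonneg.2 hab)
  have h5 : a * (A * b / (a * B) - 1) ≤ (b - a) * (1 - b / B) := by
    have e1 : a * (A * b / (a * B) - 1) = (A * b - a * B) / B := by field_simp
    have e2 : (b - a) * (1 - b / B) = (b - a) * (B - b) / B := by field_simp
    rw [e1, e2]
    gcongr
    nlinarith
  nlinarith

lemma mul_log_div_nonneg {a A : ℝ} (ha : 0 ≤ a) (haA : a ≤ A) : 0 ≤ a * Real.log (A / a) := by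
  simpa using mul_log_div_mono (le_refl (0 : ℝ)) ha (le_refl (0 : ℝ)) (by simpa using haA)

/-- The Gibbs inequality for a single term. -/
lemma mul_log_div_le {A S α : ℝ} (hA : 0 ≤ A) (hAS : A ≤ S) (hAα : A ≤ α) :
    A * Real.log (S / A) ≤ S * α - A - A * Real.log α := by
  rcases hA.eq_or_lt with rfl | hA
  · simp only [zero_mul, sub_zero]
    positivity
  have hS : 0 < S := by linarith
  have hα : 0 < α := by linarith
  have h1 := Real.log_le_sub_one_of_pos (show 0 < S / A * α by positivity)
  rw [Real.log_mul (by positivity) (by positivity)] at h1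
  have h2 := mul_le_mul_of_nonneg_left h1 hA.le
  have h3 : A * (S / A * α - 1) = S * α - A := by field_simp
  linarith

/-- Subadditivity of `a ↦ a log (S / a)`, with the logarithm split through the marginals. -/
lemma add_mul_log_div_le {a b A B : ℝ} (ha : 0 ≤ a) (hb : 0 ≤ b) (haA : a ≤ A) (hbB : b ≤ B) :
    (a + b) * Real.log ((A + B) / (a + b)) ≤
      a * Real.log (A / a) + a * Real.log ((A + B) / A)
        + (b * Real.log (B / b) + b * Real.log ((A + B) / B)) := by
  have key : ∀ {x y X Y : ℝ}, 0 ≤ x → 0 ≤ y → x ≤ X → y ≤ Y →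
      x * Real.log ((X + Y) / (x + y)) ≤ x * Real.log (X / x) + x * Real.log ((X + Y) / X) := by
    intro x y X Y hx hy hX hY
    rcases hx.eq_or_lt with rfl | hx
    · simp
    have hX' : 0 < X := by linarith
    have hS : 0 < X + Y := by linarith
    rw [← mul_add, ← Real.log_mul (by positivity) (by positivity),
      show X / x * ((X + Y) / X) = (X + Y) / x by field_simp]
    gcongr
    linarith
  have h1 := key ha hb haA hbB
  have h2 := key hb ha hbB haA
  rw [add_comm b a, add_comm B A] at h2
  linarith

lemma summable_fiber {a : ℕ × ℕ → ℝ} (has : Summable a) (j : ℕ) : Summable fun i => a (i, j) :=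
  has.comp_injective (Prod.mk_left_injective j)

lemma le_marginal {a : ℕ × ℕ → ℝ} (ha : ∀ x, 0 ≤ a x) (has : Summable a) (x : ℕ × ℕ) :
    a x ≤ ∑' i, a (i, x.2) :=
  (summable_fiber has x.2).le_tsum x.1 fun _ _ => ha _

lemma ENNReal.tsum_prod_swap (f : ℕ × ℕ → ℝ≥0∞) : ∑' x, f x = ∑' j, ∑' i, f (i, j) := by
  rw [ENNReal.tsum_comm, ← ENNReal.tsum_prod]

lemma condEnt_mono {a b : ℕ × ℕ → ℝ} (ha : ∀ x, 0 ≤ a x) (hab : ∀ x, a x ≤ b x)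
    (hbs : Summable b) : condEnt a ≤ condEnt b := by
  have has : Summable a := hbs.of_nonneg_of_le ha hab
  refine ENNReal.tsum_le_tsum fun x => ENNReal.ofReal_le_ofReal ?_
  refine mul_log_div_mono (ha x) (hab x) (le_marginal ha has x) ?_
  rw [← (summable_fiber hbs x.2).tsum_sub (summable_fiber has x.2)]
  exact le_marginal (a := fun x => b x - a x) (fun x => sub_nonneg.2 (hab x)) (hbs.sub has) x

lemma condEntExt_eq_condEnt {a : ℕ × ℕ → ℝ} (ha : ∀ x, 0 ≤ a x) (has : Summable a) :
    condEntExt a = condEnt a := by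
  rcases (tsum_nonneg ha).eq_or_lt with h | h
  · have h0 : a = 0 := (hasSum_zero_iff_of_nonneg ha).1 (h ▸ has.hasSum)
    subst h0
    simp [condEntExt, condEnt]
  · unfold condEntExt condEnt
    rw [← ENNReal.tsum_mul_left]
    refine tsum_congr fun x => ?_
    rw [← ENNReal.ofReal_mul h.le, tsum_div_const, div_div_div_cancel_right₀ h.ne', ← mul_assoc,
      mul_div_cancel₀ _ h.ne']

/-- Conditional entropy is subadditive on unnormalized families up to the binary entropy
of the two masses. -/
lemma condEnt_add_le {a b : ℕ × ℕ → ℝ} (ha : ∀ x, 0 ≤ a x) (hb : ∀ x, 0 ≤ b x)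
    (has : Summable a) (hbs : Summable b) (hab : ∑' x, a x + ∑' x, b x = 1) :
    condEnt (fun x => a x + b x) ≤
      condEnt a + condEnt b + ENNReal.ofReal (Real.binEntropy (∑' x, b x)) := by
  set α := ∑' x, a x
  set β := ∑' x, b x
  have hα0 : 0 ≤ α := tsum_nonneg ha
  have hβ0 : 0 ≤ β := tsum_nonneg hb
  have marginal : ∀ {c : ℕ × ℕ → ℝ}, (∀ x, 0 ≤ c x) → Summable c →
      HasSum (fun j => ∑' i, c (i, j)) (∑' x, c x) := by
    intro c _ hcs
    have hs : Summable (c ∘ Prod.swap) := (Equiv.prodComm ℕ ℕ).summable_iff.2 hcs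
    have h := hs.hasSum.prod_fiberwise fun j => (summable_fiber hcs j).hasSum
    rwa [show ∑' x, (c ∘ Prod.swap) x = ∑' x, c x from (Equiv.prodComm ℕ ℕ).tsum_eq c] at h
  have hA := marginal ha has
  have hB := marginal hb hbs
  set A : ℕ → ℝ := fun j => ∑' i, a (i, j)
  set B : ℕ → ℝ := fun j => ∑' i, b (i, j)
  have hA0 : ∀ j, 0 ≤ A j := fun j => tsum_nonneg fun i => ha _
  have hB0 : ∀ j, 0 ≤ B j := fun j => tsum_nonneg fun i => hb _
  have hAα : ∀ j, A j ≤ α := fun j => le_hasSum hA j fun k _ => hA0 k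
  have hBβ : ∀ j, B j ≤ β := fun j => le_hasSum hB j fun k _ => hB0 k
  have hlogA : ∀ j, 0 ≤ Real.log ((A j + B j) / A j) := fun j => by
    rcases (hA0 j).eq_or_lt with h | h
    · simp [← h]
    · exact Real.log_nonneg (by rw [le_div_iff₀ h]; linarith [hB0 j])
  have hlogB : ∀ j, 0 ≤ Real.log ((A j + B j) / B j) := fun j => by
    rcases (hB0 j).eq_or_lt with h | h
    · simp [← h]
    · exact Real.log_nonneg (by rw [le_div_iff₀ h]; linarith [hA0 j])
  have hmass : ∀ {c : ℕ × ℕ → ℝ}, (∀ x, 0 ≤ c x) → Summable c → ∀ j {t : ℝ}, 0 ≤ t →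
      ∑' i, ENNReal.ofReal (c (i, j) * t) = ENNReal.ofReal ((∑' i, c (i, j)) * t) := by
    intro c hc hcs j t ht
    rw [← ENNReal.ofReal_tsum_of_nonneg (fun i => mul_nonneg (hc _) ht)
      ((summable_fiber hcs j).mul_right t), tsum_mul_right]
  have hlogα : Real.log α ≤ 0 := Real.log_nonpos hα0 (by linarith)
  have hlogβ : Real.log β ≤ 0 := Real.log_nonpos hβ0 (by linarith)
  have hbin : HasSum (fun j => A j * -Real.log α + B j * -Real.log β) (Real.binEntropy β) := by
    have h := (hA.mul_right (-Real.log α)).add (hB.mul_right (-Real.log β))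
    rwa [show α * -Real.log α + β * -Real.log β = Real.binEntropy β by
      rw [Real.binEntropy, show 1 - β = α by linarith, Real.log_inv, Real.log_inv]; ring] at h
  rw [← hbin.tsum_eq, ENNReal.ofReal_tsum_of_nonneg (fun j => add_nonneg
    (mul_nonneg (hA0 j) (by linarith)) (mul_nonneg (hB0 j) (by linarith))) hbin.summable]
  unfold condEnt
  rw [ENNReal.tsum_prod_swap, ENNReal.tsum_prod_swap (fun x => ENNReal.ofReal (a x * _)),
    ENNReal.tsum_prod_swap (fun x => ENNReal.ofReal (b x * _)),
    ← ENNReal.tsum_add, ← ENNReal.tsum_add]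
  refine ENNReal.tsum_le_tsum fun j => ?_
  have hgibbs : A j * Real.log ((A j + B j) / A j) + B j * Real.log ((A j + B j) / B j) ≤
      A j * -Real.log α + B j * -Real.log β := by
    have h1 := mul_log_div_le (hA0 j) (le_add_of_nonneg_right (hB0 j)) (hAα j)
    have h2 := mul_log_div_le (hB0 j) (le_add_of_nonneg_left (hA0 j)) (hBβ j)
    have h3 : (A j + B j) * α + (A j + B j) * β = A j + B j := by rw [← mul_add, hab, mul_one]
    linarith
  refine le_trans ?_ (add_le_add_right (ENNReal.ofReal_le_ofReal hgibbs) _)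
  rw [ENNReal.ofReal_add (mul_nonneg (hA0 j) (hlogA j)) (mul_nonneg (hB0 j) (hlogB j)),
    ← hmass ha has j (hlogA j), ← hmass hb hbs j (hlogB j), ← ENNReal.tsum_add,
    ← ENNReal.tsum_add, ← ENNReal.tsum_add]
  refine ENNReal.tsum_le_tsum fun i => ?_
  simp only
  have haA := le_marginal ha has (i, j)
  have hbB := le_marginal hb hbs (i, j)
  rw [(summable_fiber has j).tsum_add (summable_fiber hbs j)]
  refine (ENNReal.ofReal_le_ofReal (add_mul_log_div_le (ha _) (hb _) haA hbB)).trans_eq ?_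
  have n1 := mul_log_div_nonneg (ha _) haA
  have n2 := mul_log_div_nonneg (hb _) hbB
  have n3 := mul_nonneg (ha (i, j)) (hlogA j)
  have n4 := mul_nonneg (hb (i, j)) (hlogB j)
  rw [ENNReal.ofReal_add (add_nonneg n1 n3) (add_nonneg n2 n4), ENNReal.ofReal_add n1 n3,
    ENNReal.ofReal_add n2 n4]
  exact add_add_add_comm _ _ _ _

lemma gFun_mono {x y : ℝ} (hx : 0 ≤ x) (hxy : x ≤ y) : gFun x ≤ gFun y := by
  have key : ∀ {t : ℝ}, 0 ≤ t →
      gFun t = t * Real.log ((t + 1) / t) + Real.log (t + 1) := by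
    intro t ht
    rcases ht.eq_or_lt with rfl | ht
    · simp [gFun]
    · rw [gFun, Real.log_div (by positivity) (by positivity)]
      ring
  rw [key hx, key (hx.trans hxy)]
  have h1 := mul_log_div_mono hx hxy (show x ≤ x + 1 by linarith)
    (show y - x ≤ y + 1 - (x + 1) by linarith)
  have h2 : Real.log (x + 1) ≤ Real.log (y + 1) :=
    Real.log_le_log (by linarith) (by linarith)
  linarith

lemma binEntropy_le_gFun {x : ℝ} (hx : 0 ≤ x) (hx1 : x ≤ 1) : Real.binEntropy x ≤ gFun x := by
  have key : ∀ {t : ℝ}, 0 ≤ t → t - 1 ≤ t * Real.log t := by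
    intro t ht
    rcases ht.eq_or_lt with rfl | ht
    · simp
    · have h := mul_le_mul_of_nonneg_left (Real.one_sub_inv_le_log_of_pos ht) ht.le
      rwa [mul_sub, mul_one, mul_inv_cancel₀ ht.ne'] at h
  have h1 := key (show 0 ≤ 1 - x by linarith)
  have h2 := key (show 0 ≤ x + 1 by linarith)
  rw [Real.binEntropy, gFun, Real.log_inv, Real.log_inv]
  linarith

/-- for a joint probability distribution `p̄` on `ℕ×ℕ` with
`H(X₁|X₂)_p̄ < +∞`, `ε ∈ (0,1]`, and any joint probability distribution `q̄` with
`TV(p̄,q̄) ≤ ε`, one has `H(X₁|X₂)_q̄ ≥ H(X₁|X₂)_p̄ − H̃(X₁|X₂)_{p̄∧ε} − g(ε)`,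
stated in `[0,+∞]` as `H(X₁|X₂)_p̄ ≤ H(X₁|X₂)_q̄ + H̃(X₁|X₂)_{p̄∧ε} + g(ε)`. -/
theorem condEnt_local_lower_bound_wedge (p q : ℕ × ℕ → ℝ)
    (hp0 : ∀ x, 0 ≤ p x) (hps : Summable p) (hp1 : ∑' x, p x = 1)
    (hpfin : condEnt p ≠ ∞)
    (hq0 : ∀ x, 0 ≤ q x) (hqs : Summable q) (hq1 : ∑' x, q x = 1)
    (ε : ℝ) (hε : ε ∈ Set.Ioc (0 : ℝ) 1)
    (hTV : (1 / 2) * ∑' x, |p x - q x| ≤ ε) :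
    condEnt p
      ≤ condEnt q + condEntExt (fun x => min (p x) ε) + ENNReal.ofReal (gFun ε) := by
  obtain ⟨hε0, -⟩ := hε
  set m : ℕ × ℕ → ℝ := fun x => min (p x) (q x) with hm
  set r : ℕ × ℕ → ℝ := fun x => p x - m x with hr
  have hm0 : ∀ x, 0 ≤ m x := fun x => le_min (hp0 x) (hq0 x)
  have hms : Summable m := hps.of_nonneg_of_le hm0 fun x => min_le_left _ _
  have hr0 : ∀ x, 0 ≤ r x := fun x => sub_nonneg.2 (min_le_left _ _)
  have hrs : Summable r := hps.sub hms
  have hmr : ∑' x, m x + ∑' x, r x = 1 := by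
    rw [hps.tsum_sub hms, hp1]
    ring
  have hrε : ∑' x, r x ≤ ε := by
    have habs : ∑' x, |p x - q x| = 2 * ∑' x, r x := by
      have h : ∀ x, |p x - q x| = 2 * r x - (p x - q x) := fun x => by
        rcases le_total (p x) (q x) with h | h
        · simp only [hr, hm, min_eq_left h, abs_of_nonpos (sub_nonpos.2 h)]
          ring
        · simp only [hr, hm, min_eq_right h, abs_of_nonneg (sub_nonneg.2 h)]
          ring
      rw [tsum_congr h, (hrs.mul_left 2).tsum_sub (hps.sub hqs), hps.tsum_sub hqs, hp1, hq1,
        tsum_mul_left]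
      ring
    linarith
  have hw0 : ∀ x, 0 ≤ min (p x) ε := fun x => le_min (hp0 x) hε0.le
  have hws : Summable fun x => min (p x) ε := hps.of_nonneg_of_le hw0 fun x => min_le_left _ _
  have hrw : ∀ x, r x ≤ min (p x) ε := fun x =>
    le_min (sub_le_self _ (hm0 x)) ((hrs.le_tsum x fun y _ => hr0 y).trans hrε)
  have hr1 : ∑' x, r x ≤ 1 := by
    have : 0 ≤ ∑' x, m x := tsum_nonneg hm0
    linarith
  have hadd := condEnt_add_le hm0 hr0 hms hrs hmr
  rw [show (fun x => m x + r x) = p from funext fun x => add_sub_cancel _ _] at hadd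
  rw [condEntExt_eq_condEnt hw0 hws]
  refine hadd.trans (add_le_add (add_le_add ?_ ?_) (ENNReal.ofReal_le_ofReal ?_))
  · exact condEnt_mono hm0 (fun x => min_le_right _ _) hqs
  · exact condEnt_mono hr0 hrw hws
  · exact (binEntropy_le_gFun (tsum_nonneg hr0) hr1).trans (gFun_mono (tsum_nonneg hr0) hrε)
end
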